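/- arXiv:2501.04375 — 5 statements merged into one kernel-verified Lean document; each statement's English description precedes it below -/
import Mathlib

section
/- Let f ∈ 𝒦 have radius of convergence R > 0 and fulcrum F. Assume limsup_{s↑ln R} |F^{(k)}(s)|/F″(s)^{k/2} < +∞ for every integer k ≥ 3. Then f is Gaussian if and only if lim_{s↑ln R} F^{(k)}(s)/F″(s)^{k/2} = 0 for every integer k ≥ 3. -/
open scoped BigOperators Topology
open Filter

namespace KhinchinPaper

/-- Sum of the power series with coefficients `a` at `t`. -/
noncomputable def fsum (a : ℕ → ℝ) (t : ℝ) : ℝ := ∑' n : ℕ, a n * t ^ n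

/-- The class `𝒦`: non-constant power series with non-negative coefficients, `a 0 > 0`,
and radius of convergence `R > 0`. -/
structure IsK (a : ℕ → ℝ) (R : ℝ) : Prop where
  pos₀ : 0 < a 0
  nonneg : ∀ n, 0 ≤ a n
  nonconst : ∃ n, 0 < n ∧ 0 < a n
  Rpos : 0 < R
  conv : ∀ t : ℝ, 0 ≤ t → t < R → Summable fun n : ℕ => a n * t ^ n
  radius : ∀ t : ℝ, R < t → ¬ Summable fun n : ℕ => a n * t ^ n

/-- Mean function `m_f(t) = t f'(t)/f(t)`. -/
noncomputable def mf (a : ℕ → ℝ) (t : ℝ) : ℝ :=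
  (∑' n : ℕ, (n : ℝ) * a n * t ^ n) / fsum a t

/-- Variance function `σ_f²(t)`. -/
noncomputable def sigma2 (a : ℕ → ℝ) (t : ℝ) : ℝ :=
  (∑' n : ℕ, (n : ℝ) ^ 2 * a n * t ^ n) / fsum a t - (mf a t) ^ 2

noncomputable def sigma (a : ℕ → ℝ) (t : ℝ) : ℝ := Real.sqrt (sigma2 a t)

/-- `k`-th moment of the normalized Khinchin family variable `X̆_t`. -/
noncomputable def normMoment (a : ℕ → ℝ) (t : ℝ) (k : ℕ) : ℝ :=
  ∑' n : ℕ, (a n * t ^ n / fsum a t) * (((n : ℝ) - mf a t) / sigma a t) ^ k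

/-- `k`-th central moment of `X_t`. -/
noncomputable def centralMoment (a : ℕ → ℝ) (t : ℝ) (k : ℕ) : ℝ :=
  ∑' n : ℕ, (a n * t ^ n / fsum a t) * ((n : ℝ) - mf a t) ^ k

/-- Characteristic function `E(e^{iθ X̆_t})` of the normalized variable. -/
noncomputable def charfun (a : ℕ → ℝ) (t θ : ℝ) : ℂ :=
  ∑' n : ℕ, ((a n * t ^ n / fsum a t : ℝ) : ℂ) *
    Complex.exp (Complex.I * (θ : ℂ) * ((((n : ℝ) - mf a t) / sigma a t : ℝ) : ℂ))

/-- `f` is Gaussian: `X̆_t → N(0,1)` in distribution as `t ↑ R`, expressed via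
pointwise convergence of characteristic functions (Lévy's continuity theorem). -/
def IsGaussian (a : ℕ → ℝ) (R : ℝ) : Prop :=
  ∀ θ : ℝ, Tendsto (fun t => charfun a t θ) (𝓝[<] R)
    (𝓝 (Complex.exp (-(θ : ℂ) ^ 2 / 2)))

/-- Gaussian for entire `f` (radius `R = ∞`, so `t → +∞`). -/
def IsGaussianEntire (a : ℕ → ℝ) : Prop :=
  ∀ θ : ℝ, Tendsto (fun t => charfun a t θ) atTop
    (𝓝 (Complex.exp (-(θ : ℂ) ^ 2 / 2)))

/-- The fulcrum `F(s) = log f(e^s)` restricted to the real axis. -/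
noncomputable def fulcrum (a : ℕ → ℝ) (s : ℝ) : ℝ := Real.log (fsum a (Real.exp s))

/-- The quotient `F^{(j)}(s) / F''(s)^{j/2}`. -/
noncomputable def Fq (a : ℕ → ℝ) (j : ℕ) (s : ℝ) : ℝ :=
  iteratedDeriv j (fulcrum a) s / (iteratedDeriv 2 (fulcrum a) s) ^ ((j : ℝ) / 2)

/-- Tuples `(m₂, …, m_n)` of non-negative integers with `2m₂ + ⋯ + n m_n = n`,
padded with `m₀ = m₁ = 0` and encoded as functions on `Fin (n+1)`. -/
def tuples (n : ℕ) : Finset (Fin (n + 1) → ℕ) :=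
  (Fintype.piFinset fun _ : Fin (n + 1) => Finset.range (n + 1)).filter
    fun m => m 0 = 0 ∧ m 1 = 0 ∧ ∑ j : Fin (n + 1), (j : ℕ) * m j = n

/-- Integer moments of a standard normal random variable `Z`. -/
noncomputable def gaussMoment (k : ℕ) : ℝ :=
  if Even k then (Nat.factorial k : ℝ) / ((Nat.factorial (k / 2) : ℝ) * 2 ^ (k / 2)) else 0

/-- The complex power series sum. -/
noncomputable def fsumC (a : ℕ → ℝ) (z : ℂ) : ℂ := ∑' n : ℕ, (a n : ℂ) * z ^ n

/-- The complex fulcrum `F(z) = log f(e^z)`. -/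
noncomputable def fulcrumC (a : ℕ → ℝ) (z : ℂ) : ℂ := Complex.log (fsumC a (Complex.exp z))

end KhinchinPaper

namespace KhinchinPaper

open MeasureTheory ProbabilityTheory

theorem iteratedDeriv_comp_mul_left (f : ℝ → ℝ) (c : ℝ) (n : ℕ) :
    iteratedDeriv n (fun x => f (c * x)) = fun x => c ^ n * iteratedDeriv n f (c * x) := by
  induction n with
  | zero => simp
  | succ n ih =>
    funext x
    rw [iteratedDeriv_succ, ih, deriv_const_mul_field]
    have h := deriv_comp_mul_left c (iteratedDeriv n f) x
    rw [h, iteratedDeriv_succ, smul_eq_mul]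
    ring

/-- The recurrence expressing the moments `M` in terms of the cumulants `κ`. -/
def CumulantRec (M κ : ℕ → ℝ) : Prop :=
  M 0 = 1 ∧ ∀ n, M (n + 1) =
    ∑ j ∈ Finset.range (n + 1), (n.choose j : ℝ) * κ (j + 1) * M (n - j)

theorem cumulantRec_moments {Ω : Type*} [MeasurableSpace Ω] {P : Measure Ω}
    [IsProbabilityMeasure P] {Y : Ω → ℝ} (h : 0 ∈ interior (integrableExpSet Y P)) :
    CumulantRec (fun k => ∫ ω, Y ω ^ k ∂P) (fun k => iteratedDeriv k (cgf Y P) 0) := by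
  refine ⟨by simp, fun n => ?_⟩
  have hM : ∀ k, ∫ ω, Y ω ^ k ∂P = iteratedDeriv k (mgf Y P) 0 := fun k => by
    rw [iteratedDeriv_mgf_zero h]; rfl
  have hd : deriv (mgf Y P) =ᶠ[𝓝 0] deriv (cgf Y P) * mgf Y P := by
    filter_upwards [isOpen_interior.mem_nhds h] with u hu
    have hpos : 0 < mgf Y P u := mgf_pos (interior_subset (s := integrableExpSet Y P) hu)
    rw [Pi.mul_apply, deriv_cgf hu, deriv_mgf hu, div_mul_cancel₀ _ hpos.ne']
  simp only [hM]
  rw [iteratedDeriv_succ', hd.iteratedDeriv_eq, iteratedDeriv_mul]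
  · simp only [iteratedDeriv_succ']
  · exact (analyticAt_cgf h).deriv.contDiffAt
  · exact (analyticAt_mgf h).contDiffAt

theorem norm_exp_I_mul_sub_sum_le (y : ℝ) (n : ℕ) :
    ‖Complex.exp (Complex.I * y) - ∑ k ∈ Finset.range n, (Complex.I * y) ^ k / (k.factorial : ℂ)‖
      ≤ |y| ^ n / n.factorial := by
  suffices H : ∀ t ∈ Set.Icc (0 : ℝ) 1, ‖Complex.exp (Complex.I * y * t) -
      ∑ k ∈ Finset.range n, (Complex.I * y * t) ^ k / (k.factorial : ℂ)‖
      ≤ (t * |y|) ^ n / n.factorial by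
    simpa using H 1 (by simp)
  induction n with
  | zero =>
    intro t _
    have : Complex.I * y * t = ((y * t : ℝ) : ℂ) * Complex.I := by push_cast; ring
    simp [this, Complex.norm_exp_ofReal_mul_I, -Complex.ofReal_mul]
  | succ n ih =>
    have hf : ∀ t : ℝ, HasDerivAt (fun t : ℝ => Complex.exp (Complex.I * y * t) -
        ∑ k ∈ Finset.range (n + 1), (Complex.I * y * t) ^ k / (k.factorial : ℂ))
        (Complex.I * y * (Complex.exp (Complex.I * y * t) -
          ∑ k ∈ Finset.range n, (Complex.I * y * t) ^ k / (k.factorial : ℂ))) t := by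
      intro t
      have h0 : HasDerivAt (fun t : ℝ => Complex.I * y * (t : ℂ)) (Complex.I * y) t := by
        simpa using (Complex.ofRealCLM.hasDerivAt (x := t)).const_mul (Complex.I * (y : ℂ))
      have h1 : HasDerivAt (fun t : ℝ => ∑ k ∈ Finset.range (n + 1),
          (Complex.I * y * t) ^ k / (k.factorial : ℂ))
          (∑ k ∈ Finset.range (n + 1),
            (k * (Complex.I * y * t) ^ (k - 1) * (Complex.I * y)) / (k.factorial : ℂ)) t :=
        HasDerivAt.fun_sum fun k _ => (h0.pow k).div_const _
      convert! h0.cexp.sub h1 using 1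
      rw [Finset.sum_range_succ', mul_sub, Finset.mul_sum]
      simp only [Nat.cast_zero, zero_mul, zero_div, add_zero]
      congr 1
      · ring
      · refine Finset.sum_congr rfl fun k _ => ?_
        have : (k.factorial : ℂ) ≠ 0 := by exact_mod_cast k.factorial_ne_zero
        have h2 : ((k : ℂ) + 1) ≠ 0 := by exact_mod_cast k.succ_ne_zero
        rw [Nat.factorial_succ]
        push_cast
        field_simp
    have hB : ∀ t : ℝ, HasDerivAt (fun t : ℝ => (t * |y|) ^ (n + 1) / ((n + 1).factorial : ℝ))
        (|y| * ((t * |y|) ^ n / n.factorial)) t := by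
      intro t
      convert! ((((hasDerivAt_id t).mul_const |y|).pow (n + 1)).div_const
        ((n + 1).factorial : ℝ)) using 1
      have : (n.factorial : ℝ) ≠ 0 := by exact_mod_cast n.factorial_ne_zero
      have h2 : ((n : ℝ) + 1) ≠ 0 := by positivity
      rw [Nat.factorial_succ]
      push_cast
      simp only [id]
      field_simp
    intro t ht
    refine image_norm_le_of_norm_deriv_right_le_deriv_boundary (a := 0) (b := 1)
      (fun t _ => (hf t).continuousAt.continuousWithinAt)
      (fun t _ => (hf t).hasDerivWithinAt) ?_ hB ?_ ht
    · simp [Finset.sum_range_succ']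
    · intro u hu
      rw [norm_mul, norm_mul, Complex.norm_I, one_mul, Complex.norm_real, Real.norm_eq_abs]
      exact mul_le_mul_of_nonneg_left (ih u ⟨hu.1, hu.2.le⟩) (abs_nonneg y)

/-- `φ` is approximated by its Taylor polynomials at `0` as if it were a characteristic function
with moments `M`. -/
structure TaylorBound (φ : ℝ → ℂ) (M : ℕ → ℝ) : Prop where
  even : ∀ θ n, ‖φ θ - ∑ k ∈ Finset.range (2 * n), (Complex.I * θ) ^ k / (k.factorial : ℂ) * M k‖
    ≤ |θ| ^ (2 * n) / (2 * n).factorial * M (2 * n)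
  all : ∀ θ n, ‖φ θ - ∑ k ∈ Finset.range n, (Complex.I * θ) ^ k / (k.factorial : ℂ) * M k‖
    ≤ |θ| ^ n / n.factorial * (1 + M (2 * n))

theorem taylorBound_moments {Ω : Type*} [MeasurableSpace Ω] {P : Measure Ω}
    [IsProbabilityMeasure P] {Y : Ω → ℝ} (h : 0 ∈ interior (integrableExpSet Y P)) :
    TaylorBound (fun θ => ∫ ω, Complex.exp (Complex.I * θ * Y ω) ∂P)
      (fun k => ∫ ω, Y ω ^ k ∂P) := by
  have hm : AEMeasurable Y P := aemeasurable_of_mem_interior_integrableExpSet h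
  have hint : ∀ k, Integrable (fun ω => Y ω ^ k) P :=
    fun k => integrable_pow_of_mem_interior_integrableExpSet h k
  have hinta : ∀ k, Integrable (fun ω => |Y ω| ^ k) P :=
    fun k => integrable_pow_abs_of_mem_interior_integrableExpSet h k
  have key : ∀ (θ : ℝ) (n : ℕ), ‖∫ ω, Complex.exp (Complex.I * θ * Y ω) ∂P -
      ∑ k ∈ Finset.range n, (Complex.I * θ) ^ k / (k.factorial : ℂ) * (∫ ω, Y ω ^ k ∂P : ℝ)‖
      ≤ |θ| ^ n / n.factorial * ∫ ω, |Y ω| ^ n ∂P := by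
    intro θ n
    have hintC : ∀ k, Integrable (fun ω => (Complex.I * θ) ^ k / (k.factorial : ℂ) *
        ((Y ω ^ k : ℝ) : ℂ)) P := fun k => (hint k).ofReal.const_mul _
    have hexp : Integrable (fun ω => Complex.exp (Complex.I * θ * Y ω)) P := by
      refine (integrable_const (1 : ℝ)).mono' ?_ (ae_of_all _ fun ω => ?_)
      · exact (Complex.measurable_exp.comp_aemeasurable
          ((Complex.measurable_ofReal.comp_aemeasurable hm).const_mul _)).aestronglyMeasurable
      · have : Complex.I * θ * Y ω = ((θ * Y ω : ℝ) : ℂ) * Complex.I := by push_cast; ring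
        rw [this, Complex.norm_exp_ofReal_mul_I]
    have e : ∫ ω, Complex.exp (Complex.I * θ * Y ω) ∂P -
        ∑ k ∈ Finset.range n, (Complex.I * θ) ^ k / (k.factorial : ℂ) * (∫ ω, Y ω ^ k ∂P : ℝ)
        = ∫ ω, (Complex.exp (Complex.I * θ * Y ω) - ∑ k ∈ Finset.range n,
          (Complex.I * θ) ^ k / (k.factorial : ℂ) * ((Y ω ^ k : ℝ) : ℂ)) ∂P := by
      rw [integral_sub hexp (integrable_finsetSum _ fun k _ => hintC k),
        integral_finsetSum _ fun k _ => hintC k]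
      congr 1
      refine Finset.sum_congr rfl fun k _ => ?_
      rw [integral_const_mul]
      exact congrArg _ integral_ofReal.symm
    rw [e, ← integral_const_mul]
    refine norm_integral_le_of_norm_le ((hinta n).const_mul _) (ae_of_all _ fun ω => ?_)
    have := norm_exp_I_mul_sub_sum_le (θ * Y ω) n
    rw [abs_mul, mul_pow] at this
    calc _ = _ := ?_
      _ ≤ _ := this
      _ = _ := by ring
    congr 2
    · push_cast
      ring_nf
    · refine Finset.sum_congr rfl fun k _ => ?_
      push_cast
      ring
  refine ⟨fun θ n => ?_, fun θ n => ?_⟩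
  · simpa only [(even_two_mul n).pow_abs] using key θ (2 * n)
  · refine (key θ n).trans (mul_le_mul_of_nonneg_left ?_ (by positivity))
    have : ∫ ω, (1 + Y ω ^ (2 * n)) ∂P = 1 + ∫ ω, Y ω ^ (2 * n) ∂P := by
      rw [integral_add (integrable_const _) (hint _)]; simp
    rw [← this]
    refine integral_mono (hinta n) ((integrable_const _).add (hint _)) fun ω => ?_
    have h2 : Y ω ^ (2 * n) = (|Y ω| ^ n) ^ 2 := by
      rw [← pow_mul, mul_comm n, (even_two_mul n).pow_abs]
    simp only [h2]
    nlinarith [sq_nonneg (|Y ω| ^ n - 1), sq_nonneg (|Y ω| ^ n)]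

section Limits

variable {ι : Type*} {l : Filter ι} {M κ : ι → ℕ → ℝ} {g c : ℕ → ℝ}

theorem isBigO_moments_of_cumulants (hrec : ∀ᶠ i in l, CumulantRec (M i) (κ i))
    (hκ : ∀ k, 1 ≤ k → (fun i => κ i k) =O[l] fun _ => (1 : ℝ)) (k : ℕ) :
    (fun i => M i k) =O[l] fun _ => (1 : ℝ) := by
  induction k using Nat.strong_induction_on with
  | _ k ih =>
    cases k with
    | zero =>
      refine (Asymptotics.isBigO_refl (fun _ => (1 : ℝ)) l).congr' ?_ EventuallyEq.rfl
      filter_upwards [hrec] with i hi using hi.1.symm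
    | succ n =>
      refine Asymptotics.IsBigO.congr' (f₁ := fun i => ∑ j ∈ Finset.range (n + 1),
        (n.choose j : ℝ) * κ i (j + 1) * M i (n - j)) ?_ ?_ EventuallyEq.rfl
      · refine Asymptotics.IsBigO.fun_sum fun j _ => ?_
        simpa using ((hκ (j + 1) (by omega)).const_mul_left (n.choose j : ℝ)).mul
          (ih (n - j) (by omega))
      · filter_upwards [hrec] with i hi using (hi.2 n).symm

theorem tendsto_moments_of_cumulants (hrec : ∀ᶠ i in l, CumulantRec (M i) (κ i))
    (hlim : CumulantRec g c) (hκ : ∀ k, 1 ≤ k → Tendsto (fun i => κ i k) l (𝓝 (c k))) (k : ℕ) :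
    Tendsto (fun i => M i k) l (𝓝 (g k)) := by
  induction k using Nat.strong_induction_on with
  | _ k ih =>
    cases k with
    | zero =>
      rw [hlim.1]
      refine tendsto_const_nhds.congr' ?_
      filter_upwards [hrec] with i hi using hi.1.symm
    | succ n =>
      rw [hlim.2]
      refine Tendsto.congr' (f₁ := fun i => ∑ j ∈ Finset.range (n + 1),
        (n.choose j : ℝ) * κ i (j + 1) * M i (n - j)) ?_ ?_
      · filter_upwards [hrec] with i hi using (hi.2 n).symm
      · exact tendsto_finsetSum _ fun j _ =>
          ((hκ (j + 1) (by omega)).const_mul _).mul (ih (n - j) (by omega))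

theorem tendsto_cumulants_of_moments (hrec : ∀ᶠ i in l, CumulantRec (M i) (κ i))
    (hlim : CumulantRec g c) (hM : ∀ k, Tendsto (fun i => M i k) l (𝓝 (g k))) (k : ℕ)
    (hk : 1 ≤ k) : Tendsto (fun i => κ i k) l (𝓝 (c k)) := by
  induction k using Nat.strong_induction_on with
  | _ k ih =>
    obtain ⟨n, rfl⟩ : ∃ n, k = n + 1 := ⟨k - 1, by omega⟩
    have solve : ∀ {m d : ℕ → ℝ}, CumulantRec m d → d (n + 1) =
        m (n + 1) - ∑ j ∈ Finset.range n, (n.choose j : ℝ) * d (j + 1) * m (n - j) := by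
      intro m d h
      rw [h.2 n, Finset.sum_range_succ]
      simp [h.1]
    rw [solve hlim]
    refine Tendsto.congr' (f₁ := fun i => M i (n + 1) - ∑ j ∈ Finset.range n,
      (n.choose j : ℝ) * κ i (j + 1) * M i (n - j)) ?_ ?_
    · filter_upwards [hrec] with i hi using (solve hi).symm
    · refine (hM _).sub (tendsto_finsetSum _ fun j hj => ?_)
      have hj' := Finset.mem_range.1 hj
      exact ((ih (j + 1) (by omega) (by omega)).const_mul _).mul (hM _)

variable {φ : ι → ℝ → ℂ} {ψ : ℝ → ℂ}

theorem tendsto_of_tendsto_moments (hφ : ∀ᶠ i in l, TaylorBound (φ i) (M i))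
    (hψ : TaylorBound ψ g) (hM : ∀ k, Tendsto (fun i => M i k) l (𝓝 (g k))) {θ : ℝ}
    (hg : Tendsto (fun n => |θ| ^ (2 * n) / (2 * n).factorial * g (2 * n)) atTop (𝓝 0)) :
    Tendsto (fun i => φ i θ) l (𝓝 (ψ θ)) := by
  rw [Metric.tendsto_nhds]
  intro ε hε
  obtain ⟨n, hn⟩ := (hg.eventually (gt_mem_nhds (show (0 : ℝ) < ε / 3 by positivity))).exists
  have h1 : ∀ᶠ i in l, |θ| ^ (2 * n) / (2 * n).factorial * M i (2 * n) < ε / 3 :=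
    ((hM (2 * n)).const_mul _).eventually (gt_mem_nhds hn)
  have h2 : Tendsto (fun i => ∑ k ∈ Finset.range (2 * n),
      (Complex.I * θ) ^ k / (k.factorial : ℂ) * (M i k : ℂ)) l
      (𝓝 (∑ k ∈ Finset.range (2 * n), (Complex.I * θ) ^ k / (k.factorial : ℂ) * (g k : ℂ))) :=
    tendsto_finsetSum _ fun k _ =>
      ((Complex.continuous_ofReal.tendsto _).comp (hM k)).const_mul _
  filter_upwards [hφ, h1, Metric.tendsto_nhds.1 h2 (ε / 3) (by positivity)] with i hi h1i h2i
  have a1 := (hi.even θ n).trans_lt h1i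
  have a2 := (hψ.even θ n).trans_lt hn
  rw [← dist_eq_norm] at a1 a2
  rw [dist_comm] at a2
  have tri := dist_triangle4 (φ i θ)
    (∑ k ∈ Finset.range (2 * n), (Complex.I * θ) ^ k / (k.factorial : ℂ) * (M i k : ℂ))
    (∑ k ∈ Finset.range (2 * n), (Complex.I * θ) ^ k / (k.factorial : ℂ) * (g k : ℂ)) (ψ θ)
  linarith

theorem tendsto_moments_of_tendsto (hφ : ∀ᶠ i in l, TaylorBound (φ i) (M i))
    (hψ : TaylorBound ψ g) (hM : ∀ k, (fun i => M i k) =O[l] fun _ => (1 : ℝ))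
    (h : ∀ θ, Tendsto (fun i => φ i θ) l (𝓝 (ψ θ))) (k : ℕ) :
    Tendsto (fun i => M i k) l (𝓝 (g k)) := by
  induction k using Nat.strong_induction_on with
  | _ k ih =>
    obtain ⟨C, hC⟩ := (hM (2 * (k + 1))).bound
    rw [Metric.tendsto_nhds]
    intro ε hε
    set D : ℝ := (1 + |C|) + (1 + |g (2 * (k + 1))|) with hD
    have hDpos : 0 < D := by positivity
    set θ : ℝ := ε / (2 * D) with hθ
    have hθpos : 0 < θ := by positivity
    have hθD : θ * D = ε / 2 := by rw [hθ]; field_simp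
    have hk : (0 : ℝ) < k.factorial := by exact_mod_cast k.factorial_pos
    set b : ℝ := θ ^ k / k.factorial with hb
    have hbpos : 0 < b := by positivity
    have hq : Tendsto (fun i => ‖φ i θ - ψ θ‖ + ∑ j ∈ Finset.range k,
        θ ^ j / j.factorial * |M i j - g j|) l (𝓝 0) := by
      have e1 : Tendsto (fun i => ‖φ i θ - ψ θ‖) l (𝓝 0) := by
        simpa using ((h θ).sub_const (ψ θ)).norm
      have e2 : Tendsto (fun i => ∑ j ∈ Finset.range k,
          θ ^ j / j.factorial * |M i j - g j|) l (𝓝 (∑ j ∈ Finset.range k, 0)) := by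
        refine tendsto_finsetSum _ fun j hj => ?_
        simpa using (((ih j (Finset.mem_range.1 hj)).sub_const (g j)).abs).const_mul
          (θ ^ j / j.factorial)
      simpa using e1.add e2
    filter_upwards [hφ, hC, hq.eventually (gt_mem_nhds (show 0 < b * (ε / 2) by positivity))]
      with i hi hCi hqi
    have a1 := hi.all θ (k + 1)
    have a2 := hψ.all θ (k + 1)
    have hMle : M i (2 * (k + 1)) ≤ |C| := by
      have : ‖M i (2 * (k + 1))‖ ≤ C := by simpa using hCi
      exact (le_abs_self _).trans (this.trans (le_abs_self C))
    have hgle := le_abs_self (g (2 * (k + 1)))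
    have hcoef : |θ| ^ (k + 1) / ((k + 1).factorial : ℝ) ≤ b * θ := by
      rw [abs_of_pos hθpos, hb, pow_succ, div_mul_eq_mul_div]
      gcongr
      omega
    have hcoef0 : 0 ≤ |θ| ^ (k + 1) / ((k + 1).factorial : ℝ) := by positivity
    have a1' : |θ| ^ (k + 1) / ((k + 1).factorial : ℝ) * (1 + M i (2 * (k + 1)))
        ≤ b * θ * (1 + |C|) :=
      (mul_le_mul_of_nonneg_left (by linarith) hcoef0).trans
        (mul_le_mul_of_nonneg_right hcoef (by positivity))
    have a2' : |θ| ^ (k + 1) / ((k + 1).factorial : ℝ) * (1 + g (2 * (k + 1)))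
        ≤ b * θ * (1 + |g (2 * (k + 1))|) :=
      (mul_le_mul_of_nonneg_left (by linarith) hcoef0).trans
        (mul_le_mul_of_nonneg_right hcoef (by positivity))
    have hterm : ∀ j, ‖(Complex.I * θ) ^ j / (j.factorial : ℂ) * (M i j : ℂ) -
        (Complex.I * θ) ^ j / (j.factorial : ℂ) * (g j : ℂ)‖
        = θ ^ j / j.factorial * |M i j - g j| := by
      intro j
      rw [← mul_sub, norm_mul, norm_div, norm_pow, norm_mul, Complex.norm_I, one_mul,
        Complex.norm_real, Complex.norm_natCast, ← Complex.ofReal_sub, Complex.norm_real,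
        Real.norm_eq_abs, Real.norm_eq_abs, abs_of_pos hθpos]
    rw [Finset.sum_range_succ] at a1 a2
    have hsum : ‖∑ j ∈ Finset.range k, (Complex.I * θ) ^ j / (j.factorial : ℂ) * (M i j : ℂ) -
        ∑ j ∈ Finset.range k, (Complex.I * θ) ^ j / (j.factorial : ℂ) * (g j : ℂ)‖
        ≤ ∑ j ∈ Finset.range k, θ ^ j / j.factorial * |M i j - g j| := by
      rw [← Finset.sum_sub_distrib]
      exact (norm_sum_le _ _).trans_eq (Finset.sum_congr rfl fun j _ => hterm j)
    have hk' := hterm k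
    set S₁ := ∑ j ∈ Finset.range k, (Complex.I * θ) ^ j / (j.factorial : ℂ) * (M i j : ℂ)
    set S₂ := ∑ j ∈ Finset.range k, (Complex.I * θ) ^ j / (j.factorial : ℂ) * (g j : ℂ)
    set T₁ := (Complex.I * θ) ^ k / (k.factorial : ℂ) * (M i k : ℂ)
    set T₂ := (Complex.I * θ) ^ k / (k.factorial : ℂ) * (g k : ℂ)
    have tri : ‖T₁ - T₂‖ ≤ ‖φ i θ - ψ θ‖ + ‖S₁ - S₂‖ + ‖φ i θ - (S₁ + T₁)‖
        + ‖ψ θ - (S₂ + T₂)‖ := by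
      have : T₁ - T₂ = (φ i θ - ψ θ) - (S₁ - S₂) - (φ i θ - (S₁ + T₁)) + (ψ θ - (S₂ + T₂)) := by
        ring
      rw [this]
      refine (norm_add_le _ _).trans (add_le_add_left ((norm_sub_le _ _).trans
        (add_le_add_left (norm_sub_le _ _) _)) _)
    have hfin : b * |M i k - g k| < b * ε := by
      rw [← hk']
      have : b * θ * (1 + |C|) + b * θ * (1 + |g (2 * (k + 1))|) = b * (ε / 2) := by
        rw [← hθD, hD]; ring
      linarith
    rw [Real.dist_eq]
    exact lt_of_mul_lt_mul_left hfin hbpos.le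

end Limits

section Gaussian

theorem cumulantRec_gaussian :
    CumulantRec (fun k => ∫ x, x ^ k ∂(gaussianReal 0 1)) (fun k => if k = 2 then 1 else 0) := by
  have h := cumulantRec_moments (P := gaussianReal 0 1) (Y := id) (by simp)
  have e : cgf id (gaussianReal 0 1) = fun u => u ^ 2 / 2 := by
    funext u
    simp [cgf_gaussianReal (μ := 0) (v := 1) Measure.map_id]
  rw [e] at h
  convert h using 2 with k k
  · rfl
  rw [iteratedDeriv_div_const, iteratedDeriv_fun_pow_zero]
  split_ifs <;> simp

theorem taylorBound_gaussian :
    TaylorBound (fun θ => Complex.exp (-(θ : ℂ) ^ 2 / 2))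
      (fun k => ∫ x, x ^ k ∂(gaussianReal 0 1)) := by
  convert taylorBound_moments (P := gaussianReal 0 1) (Y := id) (by simp) using 2 with θ
  on_goal 2 => rfl
  have := charFun_gaussianReal (μ := 0) (v := 1) θ
  rw [charFun_apply_real] at this
  simp only [id]
  convert this.symm using 2
  · simp; ring
  · ext x; congr 1; ring

theorem tendsto_gaussian_taylor_remainder (θ : ℝ) :
    Tendsto (fun n => |θ| ^ (2 * n) / (2 * n).factorial *
      ∫ x, x ^ (2 * n) ∂(gaussianReal 0 1)) atTop (𝓝 0) := by
  convert FloorSemiring.tendsto_pow_div_factorial_atTop (θ ^ 2 / 2) using 2 with n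
  obtain ⟨h0, hs⟩ := cumulantRec_gaussian
  induction n with
  | zero => simp
  | succ n ih =>
    have h1 := hs (2 * n + 1)
    rw [Finset.sum_eq_single 1 (by intro j _ hj; simp [hj]) (by simp)] at h1
    have h1' : ∫ x, x ^ (2 * (n + 1)) ∂(gaussianReal 0 1)
        = (2 * n + 1) * ∫ x, x ^ (2 * n) ∂(gaussianReal 0 1) := by
      simpa [mul_add] using h1
    have e : (2 * (n + 1)).factorial = (2 * n + 2) * ((2 * n + 1) * (2 * n).factorial) := by
      rw [mul_add, Nat.factorial_succ, Nat.factorial_succ]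
    have f0 : ((2 * n).factorial : ℝ) ≠ 0 := by exact_mod_cast (2 * n).factorial_ne_zero
    have f1 : (n.factorial : ℝ) ≠ 0 := by exact_mod_cast n.factorial_ne_zero
    have f2 : (2 * (n : ℝ) + 1) ≠ 0 := by positivity
    have f3 : ((n : ℝ) + 1) ≠ 0 := by positivity
    rw [h1', e, pow_succ (θ ^ 2 / 2), Nat.factorial_succ]
    push_cast
    rw [mul_comm ((n : ℝ) + 1), mul_div_mul_comm, ← ih, mul_add, pow_add, mul_one, sq_abs]
    field_simp

end Gaussian

section Tilted

variable {Ω : Type*} [MeasurableSpace Ω] {μ : Measure Ω} {X : Ω → ℝ} {s : ℝ}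

theorem integrable_exp_mul_tilted {u σ : ℝ} (m : ℝ)
    (hs : Integrable (fun ω => Real.exp (s * X ω)) μ)
    (hu : Integrable (fun ω => Real.exp ((s + σ⁻¹ * u) * X ω)) μ) :
    Integrable (fun ω => Real.exp (u * ((X ω - m) / σ))) (μ.tilted (s * X ·)) := by
  rw [integrable_tilted_iff hs]
  refine (hu.mul_const (Real.exp (-(u * m / σ)))).congr (ae_of_all _ fun ω => ?_)
  simp only [smul_eq_mul, ← Real.exp_add]
  congr 1
  ring

theorem mgf_tilted_standardize (u m σ : ℝ) :
    mgf (fun ω => (X ω - m) / σ) (μ.tilted (s * X ·)) u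
      = mgf X μ (s + σ⁻¹ * u) / mgf X μ s * Real.exp (-(u * m / σ)) := by
  have h : mgf X μ (s + σ⁻¹ * u) = ∫ ω, Real.exp ((s + σ⁻¹ * u) * X ω) ∂μ := rfl
  rw [mgf, integral_tilted_mul_eq_mgf, h, ← integral_div, ← integral_mul_const]
  refine integral_congr_ae (ae_of_all _ fun ω => ?_)
  simp only [smul_eq_mul]
  rw [div_mul_eq_mul_div, div_mul_eq_mul_div, ← Real.exp_add, ← Real.exp_add]
  congr 2
  ring

theorem zero_mem_interior_integrableExpSet_tilted (m σ : ℝ)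
    (hs : s ∈ interior (integrableExpSet X μ)) :
    0 ∈ interior (integrableExpSet (fun ω => (X ω - m) / σ) (μ.tilted (s * X ·))) := by
  rw [mem_interior_iff_mem_nhds] at hs ⊢
  have hc : Tendsto (fun u : ℝ => s + σ⁻¹ * u) (𝓝 0) (𝓝 s) := by
    have : Continuous fun u : ℝ => s + σ⁻¹ * u := by fun_prop
    simpa using this.tendsto 0
  filter_upwards [hc.eventually hs] with u hu
  exact integrable_exp_mul_tilted m (mem_of_mem_nhds (s := integrableExpSet X μ) hs) hu

theorem cgf_tilted_standardize (m σ : ℝ) (hμ : μ ≠ 0)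
    (hs : s ∈ interior (integrableExpSet X μ)) :
    cgf (fun ω => (X ω - m) / σ) (μ.tilted (s * X ·)) =ᶠ[𝓝 0]
      fun u => cgf X μ (s + σ⁻¹ * u) - (cgf X μ s + m / σ * u) := by
  rw [mem_interior_iff_mem_nhds] at hs
  have hc : Tendsto (fun u : ℝ => s + σ⁻¹ * u) (𝓝 0) (𝓝 s) := by
    have : Continuous fun u : ℝ => s + σ⁻¹ * u := by fun_prop
    simpa using this.tendsto 0
  filter_upwards [hc.eventually hs] with u hu
  have h1 : 0 < mgf X μ s := mgf_pos' hμ (mem_of_mem_nhds (s := integrableExpSet X μ) hs)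
  have h2 : 0 < mgf X μ (s + σ⁻¹ * u) := mgf_pos' hμ hu
  rw [cgf, mgf_tilted_standardize, Real.log_mul (div_pos h2 h1).ne' (Real.exp_pos _).ne',
    Real.log_div h2.ne' h1.ne', Real.log_exp, cgf, cgf]
  ring

theorem iteratedDeriv_cgf_tilted_standardize (σ : ℝ) (hμ : μ ≠ 0)
    (hs : s ∈ interior (integrableExpSet X μ)) (k : ℕ) :
    iteratedDeriv k (cgf (fun ω => (X ω - deriv (cgf X μ) s) / σ) (μ.tilted (s * X ·))) 0
      = if k ≤ 1 then 0 else iteratedDeriv k (cgf X μ) s / σ ^ k := by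
  have hF : ∀ k : ℕ, iteratedDeriv k (fun u => cgf X μ (s + σ⁻¹ * u)) 0
      = iteratedDeriv k (cgf X μ) s / σ ^ k := by
    intro k
    have := congrFun (iteratedDeriv_comp_mul_left (fun z => cgf X μ (s + z)) σ⁻¹ k) 0
    rw [iteratedDeriv_comp_const_add] at this
    simp only [mul_zero, add_zero] at this
    rw [this, inv_pow, div_eq_inv_mul]
  have hcd : ContDiffAt ℝ k (fun u => cgf X μ (s + σ⁻¹ * u)) 0 := by
    have : ContDiffAt ℝ k (cgf X μ) (s + σ⁻¹ * 0) := by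
      simpa using (analyticAt_cgf hs).contDiffAt
    exact ContDiffAt.comp (g := cgf X μ) (f := fun u => s + σ⁻¹ * u) (0 : ℝ) this (by fun_prop)
  have hlin : ∀ c d : ℝ, iteratedDeriv k (fun u : ℝ => c + d * u) 0
      = if k = 0 then c else if k = 1 then d else 0 := by
    intro c d
    rcases Nat.eq_zero_or_pos k with rfl | hk
    · simp
    · rw [iteratedDeriv_const_add hk, iteratedDeriv_const_mul_field, iteratedDeriv_fun_id_zero]
      simp [hk.ne']
  rw [(cgf_tilted_standardize _ σ hμ hs).iteratedDeriv_eq,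
    iteratedDeriv_fun_sub hcd (by fun_prop), hF, hlin]
  rcases k with _ | _ | k
  · simp
  · simp
  · simp

end Tilted

section Coefficients

variable {a : ℕ → ℝ} {R s : ℝ}

/-- The measure on `ℕ` with mass `a n` at `n`. -/
noncomputable def coeffMeasure (a : ℕ → ℝ) : Measure ℕ :=
  Measure.sum fun n => ENNReal.ofReal (a n) • Measure.dirac n

theorem integral_coeffMeasure (ha : ∀ n, 0 ≤ a n) {E : Type*} [NormedAddCommGroup E]
    [NormedSpace ℝ E] [FiniteDimensional ℝ E] (g : ℕ → E) :
    ∫ n, g n ∂(coeffMeasure a) = ∑' n, a n • g n := by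
  rw [coeffMeasure, integral_sum_dirac fun n => ENNReal.ofReal_ne_top]
  simp only [ENNReal.toReal_ofReal (ha _)]

theorem coeffMeasure_ae_imp {p : ℕ → Prop} (h : ∀ᵐ n ∂(coeffMeasure a), p n) {n : ℕ}
    (hn : 0 < a n) : p n := by
  rw [coeffMeasure, Measure.ae_sum_iff] at h
  have h' := Measure.ae_ennreal_smul_measure_iff (by simpa using hn) |>.1 (h n)
  exact (ae_dirac_iff (MeasurableSet.of_discrete)).1 h'

theorem mgf_coeffMeasure (ha : ∀ n, 0 ≤ a n) (s : ℝ) :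
    mgf (fun n : ℕ => (n : ℝ)) (coeffMeasure a) s = fsum a (Real.exp s) := by
  rw [mgf, integral_coeffMeasure ha, fsum]
  simp only [smul_eq_mul, ← Real.exp_nat_mul, mul_comm s]

theorem cgf_coeffMeasure (ha : ∀ n, 0 ≤ a n) :
    cgf (fun n : ℕ => (n : ℝ)) (coeffMeasure a) = fulcrum a := by
  funext s
  rw [cgf, mgf_coeffMeasure ha, fulcrum]

theorem IsK.mem_integrableExpSet (hK : IsK a R) (hs : s < Real.log R) :
    s ∈ integrableExpSet (fun n : ℕ => (n : ℝ)) (coeffMeasure a) := by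
  have h := hK.conv (Real.exp s) (Real.exp_pos s).le
    ((Real.lt_log_iff_exp_lt hK.Rpos).1 hs)
  refine integrable_sum_dirac (fun n => ENNReal.ofReal_ne_top) (h.congr fun n => ?_)
  rw [ENNReal.toReal_ofReal (hK.nonneg n), Real.norm_of_nonneg (Real.exp_pos _).le,
    ← Real.exp_nat_mul, mul_comm s]

theorem IsK.mem_interior (hK : IsK a R) (hs : s < Real.log R) :
    s ∈ interior (integrableExpSet (fun n : ℕ => (n : ℝ)) (coeffMeasure a)) := by
  rw [mem_interior_iff_mem_nhds]
  filter_upwards [gt_mem_nhds hs] with u hu using hK.mem_integrableExpSet hu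

theorem IsK.coeffMeasure_ne_zero (hK : IsK a R) : coeffMeasure a ≠ 0 := by
  intro h
  exact coeffMeasure_ae_imp (a := a) (p := fun _ => False) (by simp [h]) hK.pos₀

theorem IsK.isProbabilityMeasure_tilted (hK : IsK a R) (hs : s < Real.log R) :
    IsProbabilityMeasure ((coeffMeasure a).tilted fun n : ℕ => s * n) :=
  haveI : NeZero (coeffMeasure a) := ⟨hK.coeffMeasure_ne_zero⟩
  MeasureTheory.isProbabilityMeasure_tilted (hK.mem_integrableExpSet hs)

theorem IsK.iteratedDeriv_two_fulcrum_pos (hK : IsK a R) (hs : s < Real.log R) :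
    0 < iteratedDeriv 2 (fulcrum a) s := by
  have hi := hK.mem_interior hs
  have := hK.isProbabilityMeasure_tilted hs
  rw [← cgf_coeffMeasure hK.nonneg, ← variance_tilted_mul hi]
  refine (variance_nonneg _ _).lt_of_ne fun h0 => ?_
  have hae := ae_eq_integral_of_variance_eq_zero (memLp_tilted_mul hi 2) h0.symm
  have hae' := (absolutelyContinuous_tilted (hK.mem_integrableExpSet hs)).ae_le hae
  obtain ⟨n, hn, han⟩ := hK.nonconst
  have e0 := coeffMeasure_ae_imp hae' hK.pos₀
  have en := coeffMeasure_ae_imp hae' han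
  rw [← e0] at en
  exact hn.ne' (by exact_mod_cast en)

theorem IsK.mf_eq (hK : IsK a R) (hs : s < Real.log R) :
    mf a (Real.exp s) = deriv (fulcrum a) s := by
  rw [← cgf_coeffMeasure hK.nonneg, deriv_cgf (hK.mem_interior hs), mgf_coeffMeasure hK.nonneg,
    integral_coeffMeasure hK.nonneg, mf]
  congr 1
  refine tsum_congr fun n => ?_
  rw [← Real.exp_nat_mul, smul_eq_mul, mul_comm s]
  ring

theorem IsK.sigma2_eq (hK : IsK a R) (hs : s < Real.log R) :
    sigma2 a (Real.exp s) = iteratedDeriv 2 (fulcrum a) s := by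
  rw [sigma2, hK.mf_eq hs]
  rw [← cgf_coeffMeasure hK.nonneg, iteratedDeriv_two_cgf (hK.mem_interior hs),
    mgf_coeffMeasure hK.nonneg, integral_coeffMeasure hK.nonneg]
  congr 2
  refine tsum_congr fun n => ?_
  rw [← Real.exp_nat_mul, smul_eq_mul, mul_comm s]
  ring

theorem IsK.Fq_eq (hK : IsK a R) (hs : s < Real.log R) (k : ℕ) :
    Fq a k s = iteratedDeriv k (fulcrum a) s / sigma a (Real.exp s) ^ k := by
  rw [Fq, sigma, hK.sigma2_eq hs,
    Real.rpow_div_two_eq_sqrt _ (hK.iteratedDeriv_two_fulcrum_pos hs).le, Real.rpow_natCast]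

theorem IsK.charfun_eq (hK : IsK a R) (s θ : ℝ) :
    charfun a (Real.exp s) θ = ∫ n : ℕ, Complex.exp (Complex.I * θ *
      (((n - mf a (Real.exp s)) / sigma a (Real.exp s) : ℝ) : ℂ))
      ∂((coeffMeasure a).tilted fun n : ℕ => s * n) := by
  rw [integral_tilted_mul_eq_mgf (X := fun n : ℕ => (n : ℝ)), integral_coeffMeasure hK.nonneg,
    charfun]
  refine tsum_congr fun n => ?_
  rw [mgf_coeffMeasure hK.nonneg, ← Real.exp_nat_mul, mul_comm s, smul_smul, Complex.real_smul,
    mul_div_assoc]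

/-- The standardized variable at `exp s` has a moment sequence whose cumulants are the quotients
`Fq a k s`, and which controls its characteristic function. -/
theorem IsK.exists_moments (hK : IsK a R) (hs : s < Real.log R) :
    ∃ M : ℕ → ℝ, TaylorBound (charfun a (Real.exp s)) M ∧
      CumulantRec M fun k => if k ≤ 1 then 0 else Fq a k s := by
  have hi := hK.mem_interior hs
  have := hK.isProbabilityMeasure_tilted hs
  have h0 := zero_mem_interior_integrableExpSet_tilted (mf a (Real.exp s)) (sigma a (Real.exp s)) hi
  refine ⟨fun k => ∫ n : ℕ, (((n : ℝ) - mf a (Real.exp s)) / sigma a (Real.exp s)) ^ k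
    ∂((coeffMeasure a).tilted fun n : ℕ => s * n), ?_, ?_⟩
  · convert taylorBound_moments h0 using 1
    funext θ
    exact hK.charfun_eq s θ
  · convert cumulantRec_moments h0 using 1
    funext k
    rw [hK.Fq_eq hs, hK.mf_eq hs, ← cgf_coeffMeasure hK.nonneg,
      iteratedDeriv_cgf_tilted_standardize _ hK.coeffMeasure_ne_zero hi]

theorem IsK.Fq_two (hK : IsK a R) (hs : s < Real.log R) : Fq a 2 s = 1 := by
  rw [Fq]
  norm_num
  exact (hK.iteratedDeriv_two_fulcrum_pos hs).ne'

theorem tendsto_nhdsLT_iff_tendsto_exp {α : Type*} (hR : 0 < R) (g : ℝ → α) (l : Filter α) :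
    Tendsto g (𝓝[<] R) l ↔ Tendsto (fun s => g (Real.exp s)) (𝓝[<] Real.log R) l := by
  constructor
  · intro h
    refine h.comp (tendsto_nhdsWithin_iff.2 ⟨?_, ?_⟩)
    · have := Real.continuous_exp.tendsto (Real.log R)
      rw [Real.exp_log hR] at this
      exact this.mono_left nhdsWithin_le_nhds
    · filter_upwards [self_mem_nhdsWithin] with s hs
      exact (Real.lt_log_iff_exp_lt hR).1 hs
  · intro h
    have hpos : ∀ᶠ t in 𝓝[<] R, 0 < t := nhdsWithin_le_nhds (lt_mem_nhds hR)
    have hlog : Tendsto Real.log (𝓝[<] R) (𝓝[<] Real.log R) := by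
      refine tendsto_nhdsWithin_iff.2 ⟨?_, ?_⟩
      · exact (Real.continuousAt_log hR.ne').tendsto.mono_left nhdsWithin_le_nhds
      · filter_upwards [self_mem_nhdsWithin, hpos] with t ht ht0
        exact Real.log_lt_log ht0 ht
    refine (h.comp hlog).congr' ?_
    filter_upwards [hpos] with t ht
    simp [Real.exp_log ht]

end Coefficients

/-- partial characterization of Gaussianity. If the quotients
`|F^{(k)}(s)|/F''(s)^{k/2}` are bounded as `s ↑ ln R` for every `k ≥ 3`, then `f` is
Gaussian iff all these quotients tend to `0`. -/
theorem statement9 (a : ℕ → ℝ) (R : ℝ) (hK : IsK a R)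
    (hb : ∀ k : ℕ, 3 ≤ k →
      IsBoundedUnder (· ≤ ·) (𝓝[<] Real.log R)
        (fun s => |iteratedDeriv k (fulcrum a) s| /
          (iteratedDeriv 2 (fulcrum a) s) ^ ((k : ℝ) / 2))) :
    IsGaussian a R ↔
      (∀ k : ℕ, 3 ≤ k → Tendsto (fun s => Fq a k s) (𝓝[<] Real.log R) (𝓝 0)) := by
  set l := 𝓝[<] Real.log R with hl
  have hev : ∀ᶠ s in l, s < Real.log R := self_mem_nhdsWithin
  have hex : ∀ s, ∃ M : ℕ → ℝ, s < Real.log R → TaylorBound (charfun a (Real.exp s)) M ∧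
      CumulantRec M fun k => if k ≤ 1 then 0 else Fq a k s := fun s => by
    by_cases hs : s < Real.log R
    · obtain ⟨M, hM⟩ := hK.exists_moments hs
      exact ⟨M, fun _ => hM⟩
    · exact ⟨0, fun h => absurd h hs⟩
  choose M hM using hex
  have hT : ∀ᶠ s in l, TaylorBound (charfun a (Real.exp s)) (M s) :=
    hev.mono fun s hs => (hM s hs).1
  have hC : ∀ᶠ s in l, CumulantRec (M s) fun k => if k ≤ 1 then 0 else Fq a k s :=
    hev.mono fun s hs => (hM s hs).2
  have hlow : ∀ k, 1 ≤ k → k < 3 → Tendsto (fun s => if k ≤ 1 then 0 else Fq a k s) l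
      (𝓝 (if k = 2 then 1 else 0)) := by
    intro k h1 h3
    interval_cases k
    · simp
    · refine tendsto_const_nhds.congr' ?_
      filter_upwards [hev] with s hs
      simp [hK.Fq_two hs]
  have hgauss : IsGaussian a R ↔ ∀ θ : ℝ, Tendsto (fun s => charfun a (Real.exp s) θ) l
      (𝓝 (Complex.exp (-(θ : ℂ) ^ 2 / 2))) :=
    forall_congr' fun θ => tendsto_nhdsLT_iff_tendsto_exp hK.Rpos _ _
  rw [hgauss]
  constructor
  · intro hG k hk
    have hbdd : ∀ k, 1 ≤ k → (fun s => if k ≤ 1 then 0 else Fq a k s) =O[l] fun _ => (1 : ℝ) := by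
      intro k h1
      rcases lt_or_ge k 3 with h3 | h3
      · exact (hlow k h1 h3).isBigO_one ℝ
      · obtain ⟨C, hCb⟩ := hb k h3
        refine Asymptotics.IsBigO.of_bound C ?_
        filter_upwards [eventually_map.1 hCb, hev] with s hs hsl
        rw [if_neg (by omega), norm_one, mul_one, Fq, norm_div, Real.norm_eq_abs,
          Real.norm_of_nonneg (Real.rpow_nonneg (hK.iteratedDeriv_two_fulcrum_pos hsl).le _)]
        exact hs
    have hlim := tendsto_cumulants_of_moments hC cumulantRec_gaussian
      (tendsto_moments_of_tendsto hT taylorBound_gaussian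
        (isBigO_moments_of_cumulants hC hbdd) hG) k (by omega)
    simpa [show ¬ k ≤ 1 by omega, show k ≠ 2 by omega] using hlim
  · intro hF θ
    refine tendsto_of_tendsto_moments hT taylorBound_gaussian
      (tendsto_moments_of_cumulants hC cumulantRec_gaussian fun k h1 => ?_)
      (tendsto_gaussian_taylor_remainder θ)
    rcases lt_or_ge k 3 with h3 | h3
    · exact hlow k h1 h3
    · simpa [show ¬ k ≤ 1 by omega, show k ≠ 2 by omega] using hF k h3

end KhinchinPaper
end

section
/- Let g ∈ C¹([0,+∞)) satisfy g(0) = 0 and lim_{t→+∞} g(t) = 0, and assume g and g′ are absolutely integrable on [0,+∞). Then for every s > 0: (i) | s·Σ_{j=1}^{∞} g(js) − ∫₀^∞ g(x) dx | ≤ s·∫₀^∞ |g′(x)| dx, and (ii) | s·Σ_{j=1}^{∞} g(js) − ∫₀^∞ g(x) dx | ≤ ∫₀^∞ x·|g′(x)| dx. -/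
open scoped BigOperators Topology
open Filter

namespace KhinchinPaper

open MeasureTheory

/-- Right-endpoint rectangle rule: the error on `[a, b]` is the integral of `(x - a) * g' x`. -/
theorem rectangle_sub_integral_eq {g : ℝ → ℝ} {a b : ℝ} (hab : a ≤ b)
    (hcont : ContinuousOn g (Set.Icc a b))
    (hdiff : ∀ x ∈ Set.Ioo a b, DifferentiableAt ℝ g x)
    (hint' : IntegrableOn (deriv g) (Set.Ioc a b)) :
    (b - a) * g b - ∫ x in Set.Ioc a b, g x = ∫ x in Set.Ioc a b, (x - a) * deriv g x := by
  have hint : IntervalIntegrable g volume a b :=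
    ContinuousOn.intervalIntegrable_of_Icc hab hcont
  have hint₁ : IntervalIntegrable (fun x => (x - a) * deriv g x) volume a b :=
    ((intervalIntegrable_iff_integrableOn_Ioc_of_le hab).2 hint').continuousOn_mul
      (by fun_prop)
  have hderiv : ∀ x ∈ Set.Ioo a b,
      HasDerivAt (fun x => (x - a) * g x) (g x + (x - a) * deriv g x) x := by
    intro x hx
    have h := ((hasDerivAt_id x).sub_const a).mul (hdiff x hx).hasDerivAt
    simp only [id_eq, one_mul] at h
    exact h
  have hcont₁ : ContinuousOn (fun x => (x - a) * g x) (Set.Icc a b) := by fun_prop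
  have hftc := intervalIntegral.integral_eq_sub_of_hasDerivAt_of_le hab
    hcont₁ hderiv (hint.add hint₁)
  rw [intervalIntegral.integral_add hint hint₁, intervalIntegral.integral_of_le hab,
    intervalIntegral.integral_of_le hab] at hftc
  simp only [sub_self, zero_mul, sub_zero] at hftc
  linarith

/-- The half-open intervals `(j * s, (j + 1) * s]` cover `(0, ∞)`. -/
theorem iUnion_Ioc_natCast_mul {s : ℝ} (hs : 0 < s) :
    ⋃ j : ℕ, Set.Ioc ((j : ℝ) * s) (((j : ℝ) + 1) * s) = Set.Ioi 0 := by
  have h := iUnion_Ioc_map_succ_eq_Ioi (f := fun j : ℕ => (j : ℝ) * s)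
    (fun j => by simp only [Nat.bot_eq_zero, Nat.cast_zero, zero_mul]; positivity)
    (not_bddAbove_of_tendsto_atTop (tendsto_natCast_atTop_atTop.atTop_mul_const hs))
  simpa using h

/-- The half-open intervals `(j * s, (j + 1) * s]` are pairwise disjoint. -/
theorem pairwise_disjoint_Ioc_natCast_mul {s : ℝ} (hs : 0 < s) :
    Pairwise (Function.onFun Disjoint
      fun j : ℕ => Set.Ioc ((j : ℝ) * s) (((j : ℝ) + 1) * s)) := by
  have hmono : Monotone fun j : ℕ => (j : ℝ) * s := fun i j hij => by
    have : (i : ℝ) ≤ j := by exact_mod_cast hij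
    simpa using mul_le_mul_of_nonneg_right this hs.le
  simpa using hmono.pairwise_disjoint_on_Ioc_succ

/-- Euler-summation estimates. -/
theorem statement10 (g : ℝ → ℝ) (hg : ContDiffOn ℝ 1 g (Set.Ici 0)) (hg0 : g 0 = 0)
    (hglim : Tendsto g atTop (𝓝 0))
    (hgint : IntegrableOn g (Set.Ici 0))
    (hg'int : IntegrableOn (deriv g) (Set.Ici 0))
    (s : ℝ) (hs : 0 < s) :
    |s * ∑' j : ℕ, g (((j : ℝ) + 1) * s) - ∫ x in Set.Ici (0 : ℝ), g x| ≤
        s * ∫ x in Set.Ici (0 : ℝ), |deriv g x| ∧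
    ENNReal.ofReal |s * ∑' j : ℕ, g (((j : ℝ) + 1) * s) - ∫ x in Set.Ici (0 : ℝ), g x| ≤
        ∫⁻ x in Set.Ici (0 : ℝ), ENNReal.ofReal (x * |deriv g x|) := by
  rw [integral_Ici_eq_integral_Ioi, integral_Ici_eq_integral_Ioi,
    setLIntegral_congr Ioi_ae_eq_Ici.symm]
  set I : ℕ → Set ℝ := fun j => Set.Ioc ((j : ℝ) * s) (((j : ℝ) + 1) * s) with hI
  have hU : ⋃ j, I j = Set.Ioi 0 := iUnion_Ioc_natCast_mul hs
  have hd : Pairwise (Function.onFun Disjoint I) := pairwise_disjoint_Ioc_natCast_mul hs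
  have hm : ∀ j, MeasurableSet (I j) := fun j => measurableSet_Ioc
  have hsub : ∀ j, I j ⊆ Set.Ici 0 := fun j =>
    (Set.subset_iUnion I j).trans (hU.subset.trans Set.Ioi_subset_Ici_self)
  have hsum {f : ℝ → ℝ} (hf : IntegrableOn f (Set.Ici 0)) :
      HasSum (fun j => ∫ x in I j, f x) (∫ x in Set.Ioi 0, f x) := by
    rw [← hU]
    exact hasSum_integral_iUnion hm hd (hf.mono_set (Set.iUnion_subset hsub))
  have hG := hsum hgint
  have hA := (hsum hg'int.abs).mul_left s
  have herr : ∀ j : ℕ, s * g (((j : ℝ) + 1) * s) - ∫ x in I j, g x =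
      ∫ x in I j, (x - j * s) * deriv g x := by
    intro j
    have hj : (0 : ℝ) ≤ j * s := by positivity
    have h := rectangle_sub_integral_eq (a := j * s) (b := ((j : ℝ) + 1) * s) (by linarith)
      (hg.continuousOn.mono fun x hx => hj.trans hx.1)
      (fun x hx => ((hg.differentiableOn one_ne_zero) x (hj.trans hx.1.le)).differentiableAt
        (Ici_mem_nhds (hj.trans_lt hx.1)))
      (hg'int.mono_set (hsub j))
    rwa [show ((j : ℝ) + 1) * s - j * s = s by ring] at h
  have hbound : ∀ j : ℕ, ‖s * g (((j : ℝ) + 1) * s) - ∫ x in I j, g x‖ ≤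
      s * ∫ x in I j, |deriv g x| := by
    intro j
    rw [herr, ← integral_const_mul]
    refine norm_integral_le_of_norm_le ((hg'int.mono_set (hsub j)).abs.const_mul s) ?_
    refine (ae_restrict_iff' (hm j)).2 (ae_of_all _ fun x hx => ?_)
    rw [norm_mul, Real.norm_eq_abs, Real.norm_eq_abs, abs_of_pos (sub_pos.2 hx.1)]
    gcongr
    linarith [hx.2]
  have hbound' : ∀ j : ℕ, ‖s * g (((j : ℝ) + 1) * s) - ∫ x in I j, g x‖ₑ ≤
      ∫⁻ x in I j, ENNReal.ofReal (x * |deriv g x|) := by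
    intro j
    rw [herr]
    refine (enorm_integral_le_lintegral_enorm _).trans (setLIntegral_mono' (hm j) fun x hx => ?_)
    have hj : (0 : ℝ) ≤ j * s := by positivity
    rw [Real.enorm_eq_ofReal_abs, abs_mul, abs_of_pos (sub_pos.2 hx.1)]
    gcongr
    linarith
  have hErr : Summable fun j : ℕ => s * g (((j : ℝ) + 1) * s) - ∫ x in I j, g x :=
    Summable.of_norm_bounded hA.summable hbound
  have htotal : s * ∑' j : ℕ, g (((j : ℝ) + 1) * s) - ∫ x in Set.Ioi 0, g x =
      ∑' j : ℕ, (s * g (((j : ℝ) + 1) * s) - ∫ x in I j, g x) := by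
    have h := (hErr.hasSum.add hG).tsum_eq
    simp only [sub_add_cancel, tsum_mul_left] at h
    linarith
  rw [htotal]
  constructor
  · exact tsum_of_norm_bounded hA hbound
  · rw [← Real.enorm_eq_ofReal_abs, ← hU, lintegral_iUnion hm hd]
    exact enorm_tsum_le_tsum_enorm.trans (ENNReal.tsum_le_tsum hbound')

end KhinchinPaper
end

section
/- Fix an integer p ≥ 1 and let F_p(s) = −Σ_{j=1}^{∞} ln(1 − e^{j^p s}) for s < 0 be the fulcrum of the ordinary generating function G_p(z) = ∏_{j=1}^{∞} (1 − z^{j^p})^{−1} of partitions of integers into p-th powers. Then for every integer m ≥ 0, F_p^{(m)}(−s) ~ (1/p)·ζ(1 + 1/p)·Γ(m + 1/p)·s^{−(m + 1/p)} as s ↓ 0, i.e. the ratio of the two sides tends to 1. -/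
open scoped BigOperators Topology
open Filter

namespace KhinchinPaper

open MeasureTheory Set

/-- A Riemann sum of mesh `h` over the half-line is the integral of a step function. -/
lemma tsum_riemann_eq_integral {φ : ℝ → ℝ} {h : ℝ} (hh : 0 < h)
    (hint : IntegrableOn (fun x => φ (h * ⌈x / h⌉₊)) (Ioi 0)) :
    ∑' j : ℕ, h * φ (h * ((j : ℝ) + 1)) = ∫ x in Ioi 0, φ (h * ⌈x / h⌉₊) := by
  have hmono : Monotone fun j : ℕ => h * (j : ℝ) := fun a b hab => by
    have : (a : ℝ) ≤ b := by exact_mod_cast hab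
    exact mul_le_mul_of_nonneg_left this hh.le
  have hceil : ∀ (j : ℕ) (x : ℝ), x ∈ Ioc (h * (j : ℝ)) (h * ((j + 1 : ℕ) : ℝ)) ↔
      ⌈x / h⌉₊ = j + 1 := by
    intro j x
    rw [Nat.ceil_eq_iff (Nat.succ_ne_zero j), Nat.succ_sub_one, lt_div_iff₀ hh, div_le_iff₀ hh,
      mul_comm, mul_comm h ((j + 1 : ℕ) : ℝ)]
    exact Iff.rfl
  have hU : ⋃ j : ℕ, Ioc (h * (j : ℝ)) (h * ((j + 1 : ℕ) : ℝ)) = Ioi 0 := by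
    ext x
    simp only [mem_iUnion, hceil, mem_Ioi]
    constructor
    · rintro ⟨j, hj⟩
      have : 0 < x / h := Nat.ceil_pos.1 (by omega)
      exact (div_pos_iff_of_pos_right hh).1 this
    · intro hx
      have : 0 < ⌈x / h⌉₊ := Nat.ceil_pos.2 (div_pos hx hh)
      exact ⟨⌈x / h⌉₊ - 1, by omega⟩
  have key := hasSum_integral_iUnion (μ := volume) (f := fun x => φ (h * ⌈x / h⌉₊))
    (fun j : ℕ => (measurableSet_Ioc : MeasurableSet
      (Ioc (h * (j : ℝ)) (h * ((j + 1 : ℕ) : ℝ)))))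
    hmono.pairwise_disjoint_on_Ioc_succ (by rw [hU]; exact hint)
  rw [hU] at key
  rw [← key.tsum_eq]
  refine tsum_congr fun j => ?_
  rw [setIntegral_congr_fun (g := fun _ => φ (h * ((j : ℝ) + 1))) measurableSet_Ioc]
  · have : h * ((j : ℝ) + 1) - h * j = h := by ring
    simp [this, hh.le]
  · intro x hx
    simp [(hceil j x).1 hx]

/-- The step `h * ⌈x / h⌉₊` lies to the right of `x`. -/
lemma le_mul_ceil_div {h : ℝ} (hh : 0 < h) (x : ℝ) : x ≤ h * ⌈x / h⌉₊ := by
  rw [mul_comm, ← div_le_iff₀ hh]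
  exact Nat.le_ceil _

/-- Rounding up to the mesh `h` tends to the identity as `h ↓ 0`. -/
lemma tendsto_mul_ceil_div {x : ℝ} (hx : 0 < x) :
    Tendsto (fun h : ℝ => h * ⌈x / h⌉₊) (𝓝[>] 0) (𝓝 x) := by
  have hup : Tendsto (fun h : ℝ => x + h) (𝓝[>] 0) (𝓝 x) := by
    have : Tendsto (fun h : ℝ => x + h) (𝓝 0) (𝓝 (x + 0)) := by
      exact (continuous_const.add continuous_id).tendsto 0
    rw [add_zero] at this
    exact this.mono_left nhdsWithin_le_nhds
  refine tendsto_of_tendsto_of_tendsto_of_le_of_le' tendsto_const_nhds hup ?_ ?_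
  · filter_upwards [self_mem_nhdsWithin] with h hh using le_mul_ceil_div hh x
  · filter_upwards [self_mem_nhdsWithin] with h (hh : 0 < h)
    have := (Nat.ceil_lt_add_one (div_pos hx hh).le).le
    calc h * (⌈x / h⌉₊ : ℝ) ≤ h * (x / h + 1) := mul_le_mul_of_nonneg_left this hh.le
      _ = x + h := by field_simp

section RiemannSum

variable {φ g : ℝ → ℝ}

lemma norm_step_le (hg : AntitoneOn g (Ioi 0)) (hφg : ∀ x, 0 < x → ‖φ x‖ ≤ g x)
    {h : ℝ} (hh : 0 < h) {x : ℝ} (hx : 0 < x) : ‖φ (h * ⌈x / h⌉₊)‖ ≤ g x := by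
  have hle := le_mul_ceil_div hh x
  exact (hφg _ (hx.trans_le hle)).trans (hg hx (hx.trans_le hle) hle)

lemma measurable_step (hφ : Continuous φ) (h : ℝ) :
    Measurable fun x : ℝ => φ (h * ⌈x / h⌉₊) := by
  have h1 : Measurable fun x : ℝ => (⌈x / h⌉₊ : ℝ) :=
    measurable_from_nat.comp (Nat.measurable_ceil.comp (measurable_id.div_const h))
  exact hφ.measurable.comp (h1.const_mul h)

lemma integrableOn_step (hφ : Continuous φ) (hg : AntitoneOn g (Ioi 0))
    (hgi : IntegrableOn g (Ioi 0)) (hφg : ∀ x, 0 < x → ‖φ x‖ ≤ g x) {h : ℝ} (hh : 0 < h) :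
    IntegrableOn (fun x => φ (h * ⌈x / h⌉₊)) (Ioi 0) :=
  Integrable.mono' hgi (measurable_step hφ h).aestronglyMeasurable
    ((ae_restrict_iff' measurableSet_Ioi).2 <| ae_of_all _ fun _ hx =>
      norm_step_le hg hφg hh hx)

/-- Riemann sums of a continuous function dominated by an integrable antitone one are bounded
uniformly in the mesh. -/
lemma norm_tsum_riemann_le (hφ : Continuous φ) (hg : AntitoneOn g (Ioi 0))
    (hgi : IntegrableOn g (Ioi 0)) (hφg : ∀ x, 0 < x → ‖φ x‖ ≤ g x) {h : ℝ} (hh : 0 < h) :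
    ‖∑' j : ℕ, h * φ (h * ((j : ℝ) + 1))‖ ≤ ∫ x in Ioi 0, g x := by
  rw [tsum_riemann_eq_integral hh (integrableOn_step hφ hg hgi hφg hh)]
  exact norm_integral_le_of_norm_le hgi
    ((ae_restrict_iff' measurableSet_Ioi).2 <| ae_of_all _ fun _ hx =>
      norm_step_le hg hφg hh hx)

/-- Riemann sums over the half-line converge to the integral, for a continuous function dominated
by an integrable antitone one. -/
lemma tendsto_tsum_riemann (hφ : Continuous φ) (hg : AntitoneOn g (Ioi 0))
    (hgi : IntegrableOn g (Ioi 0)) (hφg : ∀ x, 0 < x → ‖φ x‖ ≤ g x) :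
    Tendsto (fun h : ℝ => ∑' j : ℕ, h * φ (h * ((j : ℝ) + 1))) (𝓝[>] 0)
      (𝓝 (∫ x in Ioi 0, φ x)) := by
  have hlim : Tendsto (fun h : ℝ => ∫ x in Ioi 0, φ (h * ⌈x / h⌉₊)) (𝓝[>] 0)
      (𝓝 (∫ x in Ioi 0, φ x)) := by
    refine tendsto_integral_filter_of_dominated_convergence g ?_ ?_ hgi ?_
    · exact Eventually.of_forall fun h => (measurable_step hφ h).aestronglyMeasurable
    · filter_upwards [self_mem_nhdsWithin] with h hh
      exact (ae_restrict_iff' measurableSet_Ioi).2 <| ae_of_all _ fun _ hx =>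
        norm_step_le hg hφg hh hx
    · exact (ae_restrict_iff' measurableSet_Ioi).2 <| ae_of_all _ fun x hx =>
        (hφ.tendsto x).comp (tendsto_mul_ceil_div hx)
  refine hlim.congr' ?_
  filter_upwards [self_mem_nhdsWithin] with h hh
  exact (tsum_riemann_eq_integral hh (integrableOn_step hφ hg hgi hφg hh)).symm

end RiemannSum

/-- Half of the exponential decay absorbs a power. -/
lemma pow_mul_exp_neg_le (m : ℕ) {y : ℝ} (hy : 0 ≤ y) {c : ℝ} (hc : 0 < c) :
    y ^ m * Real.exp (-(c * y)) ≤ m.factorial * (2 / c) ^ m * Real.exp (-(c * y / 2)) := by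
  have h1 := Real.pow_div_factorial_le_exp (c * y / 2) (by positivity) m
  rw [div_le_iff₀ (by positivity)] at h1
  have h2 : y ^ m = (2 / c) ^ m * (c * y / 2) ^ m := by
    rw [← mul_pow]
    congr 1
    field_simp
  have h3 : Real.exp (-(c * y)) = Real.exp (-(c * y / 2)) * Real.exp (-(c * y / 2)) := by
    rw [← Real.exp_add]
    ring_nf
  have h4 : Real.exp (c * y / 2) * Real.exp (-(c * y / 2)) = 1 := by
    rw [← Real.exp_add]
    simp
  calc y ^ m * Real.exp (-(c * y))
      = (2 / c) ^ m * (c * y / 2) ^ m *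
        (Real.exp (-(c * y / 2)) * Real.exp (-(c * y / 2))) := by rw [h3, ← h2]
    _ ≤ (2 / c) ^ m * (Real.exp (c * y / 2) * m.factorial) *
        (Real.exp (-(c * y / 2)) * Real.exp (-(c * y / 2))) := by gcongr
    _ = m.factorial * (2 / c) ^ m * Real.exp (-(c * y / 2)) *
        (Real.exp (c * y / 2) * Real.exp (-(c * y / 2))) := by ring
    _ = _ := by rw [h4, mul_one]

/-- The profile whose Riemann sums give the inner sums of `F_p^{(m)}`. -/
noncomputable def profile (p m : ℕ) (x : ℝ) : ℝ := (x ^ p) ^ m * Real.exp (-x ^ p)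

/-- An antitone integrable majorant of `profile`. -/
noncomputable def majorant (p m : ℕ) (x : ℝ) : ℝ :=
  m.factorial * (2 / 1) ^ m * Real.exp (-(1 * x ^ p / 2))

lemma continuous_profile (p m : ℕ) : Continuous (profile p m) := by
  unfold profile
  fun_prop

lemma norm_profile_le (p m : ℕ) (x : ℝ) (hx : 0 < x) : ‖profile p m x‖ ≤ majorant p m x := by
  have h := pow_mul_exp_neg_le m (pow_nonneg hx.le p) one_pos
  rw [Real.norm_of_nonneg (by unfold profile; positivity)]
  simpa only [profile, majorant, one_mul] using h

lemma antitoneOn_majorant (p m : ℕ) : AntitoneOn (majorant p m) (Ioi 0) := by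
  intro x hx y _ hxy
  have hx' : (0 : ℝ) ≤ x := le_of_lt hx
  unfold majorant
  gcongr

lemma integrableOn_majorant {p : ℕ} (hp : 1 ≤ p) (m : ℕ) :
    IntegrableOn (majorant p m) (Ioi 0) := by
  have hp' : (0 : ℝ) < p := by exact_mod_cast hp
  have h := integrableOn_rpow_mul_exp_neg_mul_rpow (p := p) (s := 0) (b := 1 / 2)
    (by norm_num) hp' (by norm_num)
  refine IntegrableOn.congr_fun (h.const_mul ((m.factorial : ℝ) * (2 / 1) ^ m)) (fun x _ => ?_)
    measurableSet_Ioi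
  simp only [majorant, Real.rpow_zero, one_mul, Real.rpow_natCast]
  ring_nf

lemma integral_profile {p : ℕ} (hp : 1 ≤ p) (m : ℕ) :
    ∫ x in Ioi 0, profile p m x = 1 / (p : ℝ) * Real.Gamma ((m : ℝ) + 1 / (p : ℝ)) := by
  have hp' : (0 : ℝ) < p := by exact_mod_cast hp
  have h := integral_rpow_mul_exp_neg_rpow (p := p) (q := ((p * m : ℕ) : ℝ)) hp'
    (by have := Nat.cast_nonneg (α := ℝ) (p * m); linarith)
  have h2 : (((p * m : ℕ) : ℝ) + 1) / p = (m : ℝ) + 1 / (p : ℝ) := by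
    push_cast
    field_simp
  rw [h2] at h
  rw [← h]
  refine setIntegral_congr_fun measurableSet_Ioi fun x _ => ?_
  simp only [profile, Real.rpow_natCast, pow_mul]

/-- The frequency `j ^ p * k` (with indices shifted by one) of the exponential expansion. -/
noncomputable def freq (p : ℕ) (i : ℕ × ℕ) : ℝ := ((i.1 : ℝ) + 1) ^ p * ((i.2 : ℝ) + 1)

/-- The term `k ^ (m - 1) * j ^ (p * m) * exp (j ^ p * k * u)` of the expansion of `F_p^{(m)}`. -/
noncomputable def expTerm (p m : ℕ) (i : ℕ × ℕ) (u : ℝ) : ℝ :=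
  freq p i ^ m / ((i.2 : ℝ) + 1) * Real.exp (freq p i * u)

lemma freq_pos (p : ℕ) (i : ℕ × ℕ) : 0 < freq p i := by
  unfold freq
  positivity

lemma expTerm_pos (p m : ℕ) (i : ℕ × ℕ) (u : ℝ) : 0 < expTerm p m i u := by
  have := freq_pos p i
  unfold expTerm
  positivity

lemma add_le_freq {p : ℕ} (hp : 1 ≤ p) (i : ℕ × ℕ) : (i.1 : ℝ) + i.2 ≤ freq p i := by
  have h1 : (i.1 : ℝ) + 1 ≤ ((i.1 : ℝ) + 1) ^ p :=
    le_self_pow₀ (by have := Nat.cast_nonneg (α := ℝ) i.1; linarith) (by omega)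
  have h2 : ((i.1 : ℝ) + 1) * ((i.2 : ℝ) + 1) ≤ freq p i := by
    unfold freq
    gcongr
  have : (0 : ℝ) ≤ (i.1 : ℝ) * i.2 := by positivity
  linarith

lemma summable_expTerm {p : ℕ} (hp : 1 ≤ p) (m : ℕ) {u : ℝ} (hu : u < 0) :
    Summable fun i => expTerm p m i u := by
  obtain ⟨c, hc, rfl⟩ : ∃ c : ℝ, 0 < c ∧ u = -c := ⟨-u, by linarith, by ring⟩
  have hgeo : Summable fun n : ℕ => Real.exp ((n : ℝ) * (-(c / 2))) :=
    Real.summable_exp_nat_mul_iff.2 (by linarith)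
  have hprod := (hgeo.mul_of_nonneg hgeo (fun _ => (Real.exp_pos _).le)
    (fun _ => (Real.exp_pos _).le)).mul_left ((m.factorial : ℝ) * (2 / c) ^ m)
  refine Summable.of_nonneg_of_le (fun i => (expTerm_pos p m i _).le) (fun i => ?_) hprod
  have hf := freq_pos p i
  calc expTerm p m i (-c) ≤ freq p i ^ m * Real.exp (freq p i * -c) := by
        unfold expTerm
        gcongr
        exact div_le_self (by positivity) (by have := Nat.cast_nonneg (α := ℝ) i.2; linarith)
    _ = freq p i ^ m * Real.exp (-(c * freq p i)) := by ring_nf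
    _ ≤ m.factorial * (2 / c) ^ m * Real.exp (-(c * freq p i / 2)) :=
        pow_mul_exp_neg_le m hf.le hc
    _ ≤ m.factorial * (2 / c) ^ m *
        Real.exp ((i.1 : ℝ) * (-(c / 2)) + (i.2 : ℝ) * (-(c / 2))) := by
        have := mul_le_mul_of_nonneg_left (add_le_freq hp i) hc.le
        gcongr
        linarith
    _ = _ := by rw [Real.exp_add]

lemma hasDerivAt_expTerm (p m : ℕ) (i : ℕ × ℕ) (u : ℝ) :
    HasDerivAt (expTerm p m i) (expTerm p (m + 1) i u) u := by
  have h := (((hasDerivAt_id u).const_mul (freq p i)).exp).const_mul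
    (freq p i ^ m / ((i.2 : ℝ) + 1))
  refine h.congr_deriv ?_
  simp only [expTerm, id]
  ring

lemma hasDerivAt_tsum_expTerm {p : ℕ} (hp : 1 ≤ p) (m : ℕ) {u : ℝ} (hu : u < 0) :
    HasDerivAt (fun v => ∑' i, expTerm p m i v) (∑' i, expTerm p (m + 1) i u) u := by
  refine hasDerivAt_tsum_of_isPreconnected (t := Iio (u / 2)) (y₀ := u)
    (summable_expTerm hp (m + 1) (u := u / 2) (by linarith)) isOpen_Iio isPreconnected_Iio
    (fun i v _ => hasDerivAt_expTerm p m i v) (fun i v hv => ?_)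
    (by rw [mem_Iio]; linarith) (summable_expTerm hp m hu) (by rw [mem_Iio]; linarith)
  rw [Real.norm_of_nonneg (expTerm_pos _ _ _ _).le]
  have hf := freq_pos p i
  have hv' : v ≤ u / 2 := le_of_lt hv
  unfold expTerm
  gcongr

lemma neg_tsum_log_eq {p : ℕ} (hp : 1 ≤ p) {u : ℝ} (hu : u < 0) :
    -∑' j : ℕ, Real.log (1 - Real.exp (((j : ℝ) + 1) ^ p * u)) = ∑' i, expTerm p 0 i u := by
  rw [(summable_expTerm hp 0 hu).tsum_prod, ← tsum_neg]
  refine tsum_congr fun j => ?_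
  have hneg : ((j : ℝ) + 1) ^ p * u < 0 := mul_neg_of_pos_of_neg (by positivity) hu
  have h := Real.hasSum_pow_div_log_of_abs_lt_one (x := Real.exp (((j : ℝ) + 1) ^ p * u))
    (by rw [abs_of_pos (Real.exp_pos _)]; exact Real.exp_lt_one_iff.2 hneg)
  rw [← h.tsum_eq]
  refine tsum_congr fun k => ?_
  rw [← Real.exp_nat_mul]
  simp only [expTerm, freq, pow_zero]
  rw [one_div, inv_mul_eq_div]
  push_cast
  ring_nf

lemma iteratedDeriv_neg_tsum_log {p : ℕ} (hp : 1 ≤ p) (m : ℕ) {u : ℝ} (hu : u < 0) :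
    iteratedDeriv m
      (fun u : ℝ => -∑' j : ℕ, Real.log (1 - Real.exp (((j : ℝ) + 1) ^ p * u))) u =
      ∑' i, expTerm p m i u := by
  induction m generalizing u with
  | zero => simpa using neg_tsum_log_eq hp hu
  | succ m ih =>
    rw [iteratedDeriv_succ]
    have hev : iteratedDeriv m
        (fun u : ℝ => -∑' j : ℕ, Real.log (1 - Real.exp (((j : ℝ) + 1) ^ p * u))) =ᶠ[𝓝 u]
        fun v => ∑' i, expTerm p m i v := by
      filter_upwards [Iio_mem_nhds hu] with v hv using ih hv
    rw [hev.deriv_eq]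
    exact (hasDerivAt_tsum_expTerm hp m hu).deriv

lemma rpow_mul_expTerm {p : ℕ} (hp : 1 ≤ p) (m j k : ℕ) {s : ℝ} (hs : 0 < s) :
    s ^ ((m : ℝ) + 1 / (p : ℝ)) * expTerm p m (j, k) (-s) =
      ((k : ℝ) + 1) ^ (-(1 + 1 / (p : ℝ))) * ((((k : ℝ) + 1) * s) ^ (1 / (p : ℝ)) *
        profile p m ((((k : ℝ) + 1) * s) ^ (1 / (p : ℝ)) * ((j : ℝ) + 1))) := by
  have hk : (0 : ℝ) < (k : ℝ) + 1 := by positivity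
  have hroot : ((((k : ℝ) + 1) * s) ^ (1 / (p : ℝ))) ^ p = ((k : ℝ) + 1) * s := by
    rw [one_div, Real.rpow_inv_natCast_pow (by positivity) (by omega)]
  have hcancel : ((k : ℝ) + 1) ^ (-(1 + 1 / (p : ℝ))) * ((k : ℝ) + 1) ^ (1 / (p : ℝ)) =
      ((k : ℝ) + 1)⁻¹ := by
    rw [← Real.rpow_add hk, ← Real.rpow_neg_one]
    ring_nf
  have hexp : freq p (j, k) * -s = -(((k : ℝ) + 1) * s * ((j : ℝ) + 1) ^ p) := by
    simp only [freq]
    ring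
  unfold profile
  rw [mul_pow, hroot, expTerm, hexp, Real.rpow_add hs, Real.rpow_natCast,
    Real.mul_rpow hk.le hs.le, div_eq_mul_inv (_ ^ m), ← hcancel, freq]
  simp only [mul_pow]
  ring

lemma summable_shifted_rpow {q : ℝ} (hq : 1 < q) :
    Summable fun k : ℕ => ((k : ℝ) + 1) ^ (-q) := by
  refine ((Real.summable_one_div_nat_add_rpow 1 q).2 hq).congr fun k => ?_
  have hk : (0 : ℝ) < (k : ℝ) + 1 := by positivity
  rw [abs_of_pos hk, Real.rpow_neg hk.le, one_div]

/-- The asymptotics of the exponential expansion, normalised by the power of `s`. -/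
lemma tendsto_rpow_mul_tsum_expTerm {p : ℕ} (hp : 1 ≤ p) (m : ℕ) :
    Tendsto (fun s : ℝ => s ^ ((m : ℝ) + 1 / (p : ℝ)) * ∑' i, expTerm p m i (-s)) (𝓝[>] 0)
      (𝓝 ((∑' k : ℕ, ((k : ℝ) + 1) ^ (-(1 + 1 / (p : ℝ)))) *
        ∫ x in Ioi 0, profile p m x)) := by
  have hp' : (0 : ℝ) < 1 / (p : ℝ) := by positivity
  have hsum := summable_shifted_rpow (q := 1 + 1 / (p : ℝ)) (by linarith)
  have hroot : ∀ k : ℕ, Tendsto (fun s : ℝ => (((k : ℝ) + 1) * s) ^ (1 / (p : ℝ)))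
      (𝓝[>] 0) (𝓝[>] 0) := by
    intro k
    refine tendsto_nhdsWithin_iff.2 ⟨?_, ?_⟩
    · have hc : Continuous fun s : ℝ => (((k : ℝ) + 1) * s) ^ (1 / (p : ℝ)) :=
        (continuous_const.mul continuous_id).rpow_const fun _ => Or.inr hp'.le
      have := hc.tendsto 0
      rw [mul_zero, Real.zero_rpow hp'.ne'] at this
      exact this.mono_left nhdsWithin_le_nhds
    · filter_upwards [self_mem_nhdsWithin] with s (hs : 0 < s)
      exact Real.rpow_pos_of_pos (by positivity) _
  have hlim := tendsto_tsum_of_dominated_convergence (𝓕 := 𝓝[>] (0 : ℝ))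
    (f := fun s (k : ℕ) => ((k : ℝ) + 1) ^ (-(1 + 1 / (p : ℝ))) *
      ∑' j : ℕ, (((k : ℝ) + 1) * s) ^ (1 / (p : ℝ)) *
        profile p m ((((k : ℝ) + 1) * s) ^ (1 / (p : ℝ)) * ((j : ℝ) + 1)))
    (hsum.mul_right (∫ x in Ioi 0, majorant p m x))
    (fun k => ((tendsto_tsum_riemann (continuous_profile p m) (antitoneOn_majorant p m)
      (integrableOn_majorant hp m) (norm_profile_le p m)).comp (hroot k)).const_mul _)
    (by
      filter_upwards [self_mem_nhdsWithin] with s (hs : 0 < s)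
      intro k
      rw [norm_mul, Real.norm_of_nonneg (by positivity)]
      gcongr
      exact norm_tsum_riemann_le (continuous_profile p m) (antitoneOn_majorant p m)
        (integrableOn_majorant hp m) (norm_profile_le p m)
        (Real.rpow_pos_of_pos (by positivity) _))
  rw [tsum_mul_right] at hlim
  refine hlim.congr' ?_
  filter_upwards [self_mem_nhdsWithin] with s (hs : 0 < s)
  have hsm := summable_expTerm hp m (u := -s) (by linarith)
  rw [hsm.tsum_prod, Summable.tsum_comm (f := fun k j => expTerm p m (j, k) (-s)) (by
    exact (Equiv.prodComm ℕ ℕ).summable_iff.2 hsm), ← tsum_mul_left]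
  refine tsum_congr fun k => ?_
  rw [← tsum_mul_left, ← tsum_mul_left]
  exact tsum_congr fun j => (rpow_mul_expTerm hp m j k hs).symm

end KhinchinPaper

namespace KhinchinPaper

/-- for the fulcrum `F_p(s) = -∑_{j≥1} ln(1 - e^{j^p s})` of the OGF of
partitions into `p`-th powers, `F_p^{(m)}(-s) ~ (1/p) ζ(1+1/p) Γ(m+1/p) s^{-(m+1/p)}`
as `s ↓ 0`. -/
theorem statement11 (p : ℕ) (hp : 1 ≤ p) (m : ℕ) :
    Tendsto (fun s : ℝ =>
        iteratedDeriv m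
            (fun u : ℝ => -∑' j : ℕ, Real.log (1 - Real.exp (((j : ℝ) + 1) ^ p * u))) (-s) /
          ((1 / (p : ℝ)) * (∑' k : ℕ, ((k : ℝ) + 1) ^ (-(1 + 1 / (p : ℝ)))) *
            Real.Gamma ((m : ℝ) + 1 / (p : ℝ)) * s ^ (-((m : ℝ) + 1 / (p : ℝ)))))
      (𝓝[>] (0 : ℝ)) (𝓝 1) := by
  have hp' : (0 : ℝ) < 1 / (p : ℝ) := by positivity
  have hlim := tendsto_rpow_mul_tsum_expTerm hp m
  set Z : ℝ := ∑' k : ℕ, ((k : ℝ) + 1) ^ (-(1 + 1 / (p : ℝ)))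
  have hZpos : 0 < Z := by
    have hsum : Summable fun k : ℕ => ((k : ℝ) + 1) ^ (-(1 + 1 / (p : ℝ))) :=
      summable_shifted_rpow (by linarith)
    exact hsum.tsum_pos (fun k => by positivity) 0 (by positivity)
  have hG : 0 < Real.Gamma ((m : ℝ) + 1 / (p : ℝ)) := Real.Gamma_pos_of_pos (by positivity)
  rw [integral_profile hp m] at hlim
  have hL : Z * (1 / (p : ℝ) * Real.Gamma ((m : ℝ) + 1 / (p : ℝ))) ≠ 0 := by positivity
  have hdiv := hlim.div_const (Z * (1 / (p : ℝ) * Real.Gamma ((m : ℝ) + 1 / (p : ℝ))))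
  rw [div_self hL] at hdiv
  refine hdiv.congr' ?_
  filter_upwards [self_mem_nhdsWithin] with s (hs : 0 < s)
  rw [iteratedDeriv_neg_tsum_log hp m (by linarith), Real.rpow_neg hs.le]
  have hspos : 0 < s ^ ((m : ℝ) + 1 / (p : ℝ)) := Real.rpow_pos_of_pos hs _
  field_simp

end KhinchinPaper
end

section
/- For every integer p ≥ 1, the ordinary generating function G_p(z) = ∏_{j=1}^{∞} (1 − z^{j^p})^{−1} of partitions of integers into p-th powers (a power series in 𝒦 with radius of convergence 1) is Gaussian: its normalized Khinchin family X̆_t converges in distribution to the standard normal N(0,1) as t ↑ 1. -/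
open scoped BigOperators Topology
open Filter

namespace KhinchinPaper

section GeneralizedPowerSeries

variable {ι : Type*}

/-- The sum `∑ i, c i * z ^ n i` of a power series with possibly repeated exponents. -/
noncomputable def expSum (c : ι → ℝ) (n : ι → ℕ) (z : ℂ) : ℂ := ∑' i, (c i : ℂ) * z ^ n i

/-- Absolute convergence of `∑ i, c i * z ^ n i` on the open unit disc. -/
def ConvergesOnDisc (c : ι → ℝ) (n : ι → ℕ) : Prop :=
  ∀ r : ℝ, 0 < r → r < 1 → Summable fun i => |c i| * r ^ n i

/-- The coefficients of the image of `∑ i, c i * z ^ n i` under `z d/dz`. -/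
noncomputable def eulerCoeff (c : ι → ℝ) (n : ι → ℕ) : ι → ℝ := fun i => n i * c i

variable {c : ι → ℝ} {n : ι → ℕ}

lemma ConvergesOnDisc.eulerCoeff (h : ConvergesOnDisc c n) :
    ConvergesOnDisc (eulerCoeff c n) n := by
  intro r hr hr1
  obtain ⟨ρ, hrρ, hρ1⟩ := exists_between hr1
  have hρ : 0 < ρ := hr.trans hrρ
  have hδ : 0 < ρ / r - 1 := by
    rw [sub_pos, lt_div_iff₀ hr]; linarith
  refine Summable.of_nonneg_of_le (fun i => by positivity) (fun i => ?_)
    ((h ρ hρ hρ1).mul_left (ρ / r - 1)⁻¹)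
  have hb : (n i : ℝ) * (ρ / r - 1) ≤ (ρ / r) ^ n i := by
    have := one_add_mul_le_pow (a := ρ / r - 1) (by linarith) (n i)
    rw [add_sub_cancel] at this
    linarith
  have hb' : (n i : ℝ) * r ^ n i ≤ (ρ / r - 1)⁻¹ * ρ ^ n i := by
    rw [div_pow, le_div_iff₀ (by positivity)] at hb
    rw [inv_mul_eq_div, le_div_iff₀ hδ]
    linarith
  calc |KhinchinPaper.eulerCoeff c n i| * r ^ n i = |c i| * (n i * r ^ n i) := by
        rw [KhinchinPaper.eulerCoeff, abs_mul, Nat.abs_cast]; ring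
    _ ≤ |c i| * ((ρ / r - 1)⁻¹ * ρ ^ n i) := by gcongr
    _ = _ := by ring

lemma ConvergesOnDisc.summable_norm (h : ConvergesOnDisc c n) {z : ℂ} (hz : ‖z‖ < 1) :
    Summable fun i => ‖(c i : ℂ) * z ^ n i‖ := by
  obtain ⟨r, hzr, hr1⟩ := exists_between hz
  refine Summable.of_nonneg_of_le (fun i => norm_nonneg _) (fun i => ?_)
    (h r ((norm_nonneg z).trans_lt hzr) hr1)
  rw [norm_mul, norm_pow, Complex.norm_real, Real.norm_eq_abs]
  gcongr

lemma ConvergesOnDisc.hasDerivAt (h : ConvergesOnDisc c n) {z : ℂ} (hz : ‖z‖ < 1) :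
    ∃ D, HasDerivAt (expSum c n) D z ∧ z * D = expSum (KhinchinPaper.eulerCoeff c n) n z := by
  obtain ⟨r, hzr, hr1⟩ := exists_between hz
  have hzU : z ∈ Metric.ball (0 : ℂ) r := by simpa using hzr
  have hsum := h r ((norm_nonneg z).trans_lt hzr) hr1
  have hdiff : ∀ i, DifferentiableOn ℂ (fun w : ℂ => (c i : ℂ) * w ^ n i) (Metric.ball 0 r) :=
    fun i => by fun_prop
  have hle : ∀ i, ∀ w ∈ Metric.ball (0 : ℂ) r, ‖(c i : ℂ) * w ^ n i‖ ≤ |c i| * r ^ n i := by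
    intro i w hw
    have hw' : ‖w‖ < r := by simpa using hw
    rw [norm_mul, norm_pow, Complex.norm_real, Real.norm_eq_abs]
    gcongr
  have hd := (Complex.differentiableOn_tsum_of_summable_norm hsum hdiff Metric.isOpen_ball
    hle).differentiableAt (Metric.isOpen_ball.mem_nhds hzU)
  have hs := Complex.hasSum_deriv_of_summable_norm hsum hdiff Metric.isOpen_ball hle hzU
  refine ⟨_, hd.hasDerivAt, ?_⟩
  rw [← (hs.mul_left z).tsum_eq]
  refine tsum_congr fun i => ?_
  have hder : HasDerivAt (fun w : ℂ => (c i : ℂ) * w ^ n i) (c i * (n i * z ^ (n i - 1))) z :=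
    (hasDerivAt_pow (n i) z).const_mul _
  rw [hder.deriv, KhinchinPaper.eulerCoeff]
  rcases Nat.eq_zero_or_pos (n i) with h0 | h0
  · simp [h0]
  · obtain ⟨k, hk⟩ := Nat.exists_eq_succ_of_ne_zero h0.ne'
    rw [hk]; push_cast; simp only [Nat.succ_eq_add_one, pow_succ]; ring

lemma ConvergesOnDisc.differentiableOn (h : ConvergesOnDisc c n) :
    DifferentiableOn ℂ (expSum c n) (Metric.ball 0 1) := fun z hz => by
  obtain ⟨D, hD, -⟩ := h.hasDerivAt (z := z) (by simpa using hz)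
  exact hD.differentiableAt.differentiableWithinAt

lemma expSum_ofReal (c : ι → ℝ) (n : ι → ℕ) (t : ℝ) :
    expSum c n t = ((∑' i, c i * t ^ n i : ℝ) : ℂ) := by
  rw [expSum, Complex.ofReal_tsum]
  push_cast
  rfl

lemma ConvergesOnDisc.hasSum_real (h : ConvergesOnDisc c n) {t : ℝ} (ht0 : 0 < t) (ht1 : t < 1) :
    HasSum (fun i => c i * t ^ n i) (∑' i, c i * t ^ n i) := by
  refine (Summable.of_norm ?_).hasSum
  refine (h t ht0 ht1).congr fun i => ?_
  rw [norm_mul, norm_pow, Real.norm_eq_abs, Real.norm_eq_abs, abs_of_pos ht0]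

end GeneralizedPowerSeries

section Exponential

variable {ι κ : Type*} {a : κ → ℝ} {l : κ → ℕ} {c : ι → ℝ} {n : ι → ℕ}

/-- Two power series related by `f = exp L` on `(0, 1)` are so related on the whole disc. -/
lemma expSum_eq_exp_of_real (ha : ConvergesOnDisc a l) (hc : ConvergesOnDisc c n)
    (h : ∀ t : ℝ, 0 < t → t < 1 → expSum a l t = Complex.exp (expSum c n t)) {z : ℂ}
    (hz : ‖z‖ < 1) : expSum a l z = Complex.exp (expSum c n z) := by
  have hA : AnalyticOnNhd ℂ (expSum a l) (Metric.ball 0 1) :=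
    ha.differentiableOn.analyticOnNhd Metric.isOpen_ball
  have hC : AnalyticOnNhd ℂ (fun z => Complex.exp (expSum c n z)) (Metric.ball 0 1) :=
    hc.differentiableOn.cexp.analyticOnNhd Metric.isOpen_ball
  refine hA.eqOn_of_preconnected_of_frequently_eq hC (convex_ball 0 1).isPreconnected
    (z₀ := ((1 / 2 : ℝ) : ℂ)) (by simp; norm_num) ?_ (by simpa using hz)
  have hreal : ∃ᶠ x : ℝ in 𝓝[≠] (1 / 2 : ℝ), expSum a l x = Complex.exp (expSum c n x) := by
    refine Eventually.frequently (nhdsWithin_le_nhds ?_)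
    filter_upwards [Ioo_mem_nhds (show (0 : ℝ) < 1 / 2 by norm_num)
      (show (1 / 2 : ℝ) < 1 by norm_num)] with x hx
    exact h x hx.1 hx.2
  rw [frequently_iff_seq_forall] at hreal ⊢
  obtain ⟨u, hu, hu'⟩ := hreal
  refine ⟨fun k => (u k : ℂ), ?_, hu'⟩
  rw [tendsto_nhdsWithin_iff] at hu ⊢
  exact ⟨(Complex.continuous_ofReal.tendsto _).comp hu.1,
    hu.2.mono fun k hk h => hk (Complex.ofReal_injective h)⟩

lemma expSum_eulerCoeff_of_eq_exp (ha : ConvergesOnDisc a l) (hc : ConvergesOnDisc c n)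
    (h : ∀ z : ℂ, ‖z‖ < 1 → expSum a l z = Complex.exp (expSum c n z)) {z : ℂ} (hz : ‖z‖ < 1) :
    expSum (eulerCoeff a l) l z = Complex.exp (expSum c n z) * expSum (eulerCoeff c n) n z := by
  obtain ⟨D, hD, hD'⟩ := ha.hasDerivAt hz
  obtain ⟨E, hE, hE'⟩ := hc.hasDerivAt hz
  have hev : expSum a l =ᶠ[𝓝 z] fun z => Complex.exp (expSum c n z) := by
    filter_upwards [Metric.isOpen_ball.mem_nhds
      (show z ∈ Metric.ball (0 : ℂ) 1 by simpa using hz)] with w hw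
    exact h w (by simpa using hw)
  rw [← hD', ← hE', hD.unique (hE.cexp.congr_of_eventuallyEq hev)]
  ring

lemma expSum_eulerCoeff_eulerCoeff_of_eq_exp (ha : ConvergesOnDisc a l)
    (hc : ConvergesOnDisc c n)
    (h : ∀ z : ℂ, ‖z‖ < 1 → expSum a l z = Complex.exp (expSum c n z)) {z : ℂ} (hz : ‖z‖ < 1) :
    expSum (eulerCoeff (eulerCoeff a l) l) l z = Complex.exp (expSum c n z) *
      (expSum (eulerCoeff c n) n z ^ 2 + expSum (eulerCoeff (eulerCoeff c n) n) n z) := by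
  obtain ⟨D, hD, hD'⟩ := ha.eulerCoeff.hasDerivAt hz
  obtain ⟨E, hE, hE'⟩ := hc.hasDerivAt hz
  obtain ⟨F, hF, hF'⟩ := hc.eulerCoeff.hasDerivAt hz
  have hev : expSum (eulerCoeff a l) l =ᶠ[𝓝 z]
      fun z => Complex.exp (expSum c n z) * expSum (eulerCoeff c n) n z := by
    filter_upwards [Metric.isOpen_ball.mem_nhds
      (show z ∈ Metric.ball (0 : ℂ) 1 by simpa using hz)] with w hw
    exact expSum_eulerCoeff_of_eq_exp ha hc h (by simpa using hw)
  rw [← hD', ← hF', hD.unique ((hE.cexp.mul hF).congr_of_eventuallyEq hev)]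
  linear_combination Complex.exp (expSum c n z) * expSum (eulerCoeff c n) n z * hE'

end Exponential

/-- A version of Taylor's estimate for `exp (i x)` valid for all real `x`. -/
lemma norm_exp_mul_I_sub_taylor_le (x : ℝ) :
    ‖Complex.exp (x * Complex.I) - 1 - x * Complex.I + (x : ℂ) ^ 2 / 2‖ ≤ 4 * |x| ^ 3 := by
  rcases le_total |x| 1 with hx | hx
  · have hn : ‖(x * Complex.I : ℂ)‖ = |x| := by simp
    have := Complex.exp_bound (x := x * Complex.I) (by rw [hn]; exact hx) (n := 3) (by norm_num)
    rw [hn] at this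
    have he : ∑ m ∈ Finset.range 3, (x * Complex.I : ℂ) ^ m / (m.factorial : ℂ) =
        1 + x * Complex.I - (x : ℂ) ^ 2 / 2 := by
      simp [Finset.sum_range_succ, mul_pow]; ring
    rw [he] at this
    have h2 : (Nat.succ 3 * ((Nat.factorial 3 : ℝ) * (3 : ℕ))⁻¹ : ℝ) ≤ 4 := by
      norm_num [Nat.factorial]
    calc _ = ‖Complex.exp (x * Complex.I) - (1 + x * Complex.I - (x : ℂ) ^ 2 / 2)‖ := by
          congr 1; ring
      _ ≤ _ := this
      _ ≤ |x| ^ 3 * 4 := by gcongr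
      _ = _ := mul_comm _ _
  · have h1 : ‖Complex.exp (x * Complex.I)‖ = 1 := Complex.norm_exp_ofReal_mul_I x
    calc _ ≤ ‖Complex.exp (x * Complex.I)‖ + ‖(1 : ℂ)‖ + ‖(x * Complex.I : ℂ)‖
            + ‖(x : ℂ) ^ 2 / 2‖ :=
          (norm_add_le _ _).trans (add_le_add_left ((norm_sub_le _ _).trans
            (add_le_add_left (norm_sub_le _ _) _)) _)
      _ = 2 + |x| + |x| ^ 2 / 2 := by rw [h1]; simp; norm_num
      _ ≤ 4 * |x| ^ 3 := by nlinarith [pow_le_pow_right₀ hx (show 2 ≤ 3 by norm_num),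
            pow_le_pow_right₀ hx (show 1 ≤ 3 by norm_num), one_le_pow₀ hx (n := 3)]

section Criterion

variable {ι : Type*} {a : ℕ → ℝ} {c : ι → ℝ} {n : ι → ℕ}

/-- The real version of `expSum`. -/
noncomputable def realSum (c : ι → ℝ) (n : ι → ℕ) (t : ℝ) : ℝ := ∑' i, c i * t ^ n i

/-- The second cumulant `∑ i, n i ^ 2 * c i * t ^ n i`. -/
noncomputable def secondSum (c : ι → ℝ) (n : ι → ℕ) (t : ℝ) : ℝ :=
  realSum (eulerCoeff (eulerCoeff c n) n) n t

/-- The third cumulant `∑ i, n i ^ 3 * c i * t ^ n i`. -/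
noncomputable def thirdSum (c : ι → ℝ) (n : ι → ℕ) (t : ℝ) : ℝ :=
  realSum (eulerCoeff (eulerCoeff (eulerCoeff c n) n) n) n t

lemma norm_ofReal_lt_one {t : ℝ} (ht0 : 0 < t) (ht1 : t < 1) : ‖(t : ℂ)‖ < 1 := by
  rwa [Complex.norm_real, Real.norm_eq_abs, abs_of_pos ht0]

lemma fsum_of_eq_exp
    (h : ∀ z : ℂ, ‖z‖ < 1 → expSum a (fun k => k) z = Complex.exp (expSum c n z))
    {t : ℝ} (ht0 : 0 < t) (ht1 : t < 1) : fsum a t = Real.exp (realSum c n t) := by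
  have := h t (norm_ofReal_lt_one ht0 ht1)
  rw [expSum_ofReal, expSum_ofReal, ← Complex.ofReal_exp] at this
  exact Complex.ofReal_injective this

lemma mf_of_eq_exp (ha : ConvergesOnDisc a fun k => k) (hc : ConvergesOnDisc c n)
    (h : ∀ z : ℂ, ‖z‖ < 1 → expSum a (fun k => k) z = Complex.exp (expSum c n z))
    {t : ℝ} (ht0 : 0 < t) (ht1 : t < 1) : mf a t = realSum (eulerCoeff c n) n t := by
  have := expSum_eulerCoeff_of_eq_exp ha hc h (norm_ofReal_lt_one ht0 ht1)
  simp only [expSum_ofReal] at this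
  rw [← Complex.ofReal_exp, ← Complex.ofReal_mul] at this
  rw [mf, fsum_of_eq_exp h ht0 ht1, div_eq_iff (Real.exp_pos _).ne']
  exact (Complex.ofReal_injective this).trans (mul_comm _ _)

lemma sigma2_of_eq_exp (ha : ConvergesOnDisc a fun k => k) (hc : ConvergesOnDisc c n)
    (h : ∀ z : ℂ, ‖z‖ < 1 → expSum a (fun k => k) z = Complex.exp (expSum c n z))
    {t : ℝ} (ht0 : 0 < t) (ht1 : t < 1) : sigma2 a t = secondSum c n t := by
  have := expSum_eulerCoeff_eulerCoeff_of_eq_exp ha hc h (norm_ofReal_lt_one ht0 ht1)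
  simp only [expSum_ofReal] at this
  rw [← Complex.ofReal_exp, ← Complex.ofReal_pow, ← Complex.ofReal_add,
    ← Complex.ofReal_mul] at this
  have hsq : ∑' k : ℕ, (k : ℝ) ^ 2 * a k * t ^ k =
      Real.exp (realSum c n t) * (realSum (eulerCoeff c n) n t ^ 2 + secondSum c n t) := by
    refine Eq.trans (tsum_congr fun k => ?_) (Complex.ofReal_injective this)
    simp only [eulerCoeff]
    ring
  rw [sigma2, mf_of_eq_exp ha hc h ht0 ht1, fsum_of_eq_exp h ht0 ht1, hsq,
    mul_div_cancel_left₀ _ (Real.exp_pos _).ne']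
  ring

lemma charfun_of_eq_exp (ha : ConvergesOnDisc a fun k => k) (hc : ConvergesOnDisc c n)
    (h : ∀ z : ℂ, ‖z‖ < 1 → expSum a (fun k => k) z = Complex.exp (expSum c n z))
    {t : ℝ} (ht0 : 0 < t) (ht1 : t < 1) (θ : ℝ) :
    charfun a t θ = Complex.exp (expSum c n (t * Complex.exp ((θ / sigma a t : ℝ) * Complex.I))
      - realSum c n t - (θ / sigma a t : ℝ) * Complex.I * realSum (eulerCoeff c n) n t) := by
  set φ : ℝ := θ / sigma a t with hφ
  have hz : ‖(t * Complex.exp (φ * Complex.I) : ℂ)‖ < 1 := by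
    rw [norm_mul, Complex.norm_exp_ofReal_mul_I, mul_one]
    exact norm_ofReal_lt_one ht0 ht1
  rw [Complex.exp_sub, Complex.exp_sub, ← h _ hz, ← Complex.ofReal_exp,
    ← fsum_of_eq_exp h ht0 ht1, ← mf_of_eq_exp ha hc h ht0 ht1, charfun, expSum,
    ← tsum_div_const, ← tsum_div_const]
  refine tsum_congr fun k => ?_
  have he : Complex.I * (θ : ℂ) * ((((k : ℝ) - mf a t) / sigma a t : ℝ) : ℂ) =
      k * (φ * Complex.I) - φ * Complex.I * mf a t := by
    rw [hφ]; push_cast; ring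
  rw [he, Complex.exp_sub, Complex.exp_nat_mul, mul_pow]
  push_cast
  ring

/-- Third order Taylor estimate of `expSum` along the circle of radius `t`. -/
lemma norm_expSum_sub_taylor_le (hc : ConvergesOnDisc c n) (hc0 : ∀ i, 0 ≤ c i)
    {t : ℝ} (ht0 : 0 < t) (ht1 : t < 1) (φ : ℝ) :
    ‖expSum c n (t * Complex.exp (φ * Complex.I)) - realSum c n t
      - φ * Complex.I * realSum (eulerCoeff c n) n t + (φ : ℂ) ^ 2 / 2 * secondSum c n t‖ ≤
      4 * |φ| ^ 3 * thirdSum c n t := by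
  have hz : ‖(t * Complex.exp (φ * Complex.I) : ℂ)‖ < 1 := by
    rw [norm_mul, Complex.norm_exp_ofReal_mul_I, mul_one]
    exact norm_ofReal_lt_one ht0 ht1
  have h0 := (hc.summable_norm hz).of_norm.hasSum
  have h1 := Complex.hasSum_ofReal.2 (hc.hasSum_real ht0 ht1)
  have h2 := (Complex.hasSum_ofReal.2 (hc.eulerCoeff.hasSum_real ht0 ht1)).mul_left
    (φ * Complex.I)
  have h3 := (Complex.hasSum_ofReal.2 (hc.eulerCoeff.eulerCoeff.hasSum_real ht0 ht1)).mul_left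
    ((φ : ℂ) ^ 2 / 2)
  have h4 := (hc.eulerCoeff.eulerCoeff.eulerCoeff.hasSum_real ht0 ht1).mul_left (4 * |φ| ^ 3)
  have hs := ((h0.sub h1).sub h2).add h3
  refine hs.norm_le_of_bounded h4 fun i => ?_
  have hterm : (c i : ℂ) * (t * Complex.exp (φ * Complex.I)) ^ n i - ((c i * t ^ n i : ℝ) : ℂ)
      - φ * Complex.I * ((eulerCoeff c n i * t ^ n i : ℝ) : ℂ)
      + (φ : ℂ) ^ 2 / 2 * ((eulerCoeff (eulerCoeff c n) n i * t ^ n i : ℝ) : ℂ) =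
      ((c i * t ^ n i : ℝ) : ℂ) * (Complex.exp ((φ * n i : ℝ) * Complex.I) - 1
        - (φ * n i : ℝ) * Complex.I + ((φ * n i : ℝ) : ℂ) ^ 2 / 2) := by
    have he : Complex.exp ((φ * n i : ℝ) * Complex.I) = Complex.exp (φ * Complex.I) ^ n i := by
      rw [← Complex.exp_nat_mul]; push_cast; ring_nf
    rw [he, mul_pow]
    simp only [eulerCoeff]
    push_cast
    ring
  rw [hterm, norm_mul, Complex.norm_real, Real.norm_eq_abs,
    abs_of_nonneg (mul_nonneg (hc0 i) (by positivity))]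
  have hci := hc0 i
  calc _ ≤ c i * t ^ n i * (4 * |φ * n i| ^ 3) := by
        gcongr
        exact norm_exp_mul_I_sub_taylor_le _
    _ = _ := by
        rw [abs_mul, Nat.abs_cast]
        simp only [eulerCoeff]
        ring

/-- If `f = exp L` with `L` having nonnegative coefficients, then `f` is Gaussian as soon as the
third cumulant is negligible against the `3 / 2` power of the variance. -/
theorem isGaussian_of_eq_exp (ha : ConvergesOnDisc a fun k => k) (hc : ConvergesOnDisc c n)
    (hc0 : ∀ i, 0 ≤ c i)
    (h : ∀ z : ℂ, ‖z‖ < 1 → expSum a (fun k => k) z = Complex.exp (expSum c n z))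
    (hpos : ∀ᶠ t in 𝓝[<] (1 : ℝ), 0 < secondSum c n t)
    (hlim : Tendsto (fun t => thirdSum c n t / Real.sqrt (secondSum c n t) ^ 3) (𝓝[<] 1) (𝓝 0)) :
    IsGaussian a 1 := by
  intro θ
  have hev : ∀ᶠ t in 𝓝[<] (1 : ℝ), 0 < t ∧ t < 1 := by
    filter_upwards [Ioo_mem_nhdsLT (show (0 : ℝ) < 1 by norm_num)] with t ht using ht
  have hexp : Tendsto (fun t : ℝ =>
      expSum c n (t * Complex.exp ((θ / sigma a t : ℝ) * Complex.I)) - realSum c n t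
        - (θ / sigma a t : ℝ) * Complex.I * realSum (eulerCoeff c n) n t)
      (𝓝[<] 1) (𝓝 (-(θ : ℂ) ^ 2 / 2)) := by
    rw [tendsto_iff_norm_sub_tendsto_zero]
    refine squeeze_zero' (Eventually.of_forall fun _ => norm_nonneg _) ?_
      (by simpa using hlim.const_mul (4 * |θ| ^ 3))
    filter_upwards [hev, hpos] with t ⟨ht0, ht1⟩ hp
    have hσ : sigma a t = Real.sqrt (secondSum c n t) := by
      rw [sigma, sigma2_of_eq_exp ha hc h ht0 ht1]
    have hσ0 : 0 < sigma a t := hσ ▸ Real.sqrt_pos.2 hp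
    have hσ2 : secondSum c n t = sigma a t ^ 2 := by rw [hσ, Real.sq_sqrt hp.le]
    have hb := norm_expSum_sub_taylor_le hc hc0 ht0 ht1 (θ / sigma a t)
    have hq : ((θ / sigma a t : ℝ) : ℂ) ^ 2 / 2 * secondSum c n t = -(-(θ : ℂ) ^ 2 / 2) := by
      have hne : (sigma a t : ℂ) ≠ 0 := by exact_mod_cast hσ0.ne'
      rw [hσ2]
      push_cast
      field_simp
    rw [hq, ← sub_eq_add_neg] at hb
    refine hb.trans_eq ?_
    rw [← hσ, abs_div, abs_of_pos hσ0]
    ring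
  refine ((Complex.continuous_exp.tendsto _).comp hexp).congr' ?_
  filter_upwards [hev] with t ⟨ht0, ht1⟩
  exact (charfun_of_eq_exp ha hc h ht0 ht1 θ).symm

end Criterion

section PowerPartitions

/-- Exponents of the expansion `∑ j m, z ^ ((m + 1) * (j + 1) ^ p) / (m + 1)` of the logarithm of
`∏ j, (1 - z ^ ((j + 1) ^ p))⁻¹`. -/
def powExponent (p : ℕ) (i : ℕ × ℕ) : ℕ := (i.2 + 1) * (i.1 + 1) ^ p

/-- Coefficients of the expansion `∑ j m, z ^ ((m + 1) * (j + 1) ^ p) / (m + 1)`. -/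
noncomputable def powCoeff (i : ℕ × ℕ) : ℝ := 1 / ((i.2 : ℝ) + 1)

lemma powCoeff_nonneg (i : ℕ × ℕ) : 0 ≤ powCoeff i := by
  unfold powCoeff; positivity

lemma convergesOnDisc_powCoeff {p : ℕ} (hp : 1 ≤ p) :
    ConvergesOnDisc powCoeff (powExponent p) := by
  intro r hr hr1
  have hg := summable_geometric_of_lt_one hr.le hr1
  refine Summable.of_nonneg_of_le (fun i => by positivity) (fun i => ?_)
    (hg.mul_of_nonneg hg (fun _ => by positivity) (fun _ => by positivity))
  have h1 : |powCoeff i| ≤ 1 := by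
    rw [abs_of_nonneg (powCoeff_nonneg i), powCoeff, div_le_one (by positivity)]
    linarith [(Nat.cast_nonneg i.2 : (0 : ℝ) ≤ i.2)]
  have h2 : i.1 + i.2 ≤ powExponent p i := by
    have : i.1 + 1 ≤ (i.1 + 1) ^ p := Nat.le_self_pow (by omega) _
    unfold powExponent
    nlinarith
  calc |powCoeff i| * r ^ powExponent p i ≤ 1 * r ^ (i.1 + i.2) := by
        gcongr ?_ * ?_
        exact pow_le_pow_of_le_one hr.le hr1.le h2
    _ = r ^ i.1 * r ^ i.2 := by rw [one_mul, pow_add]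

lemma tprod_eq_exp_realSum {p : ℕ} (hp : 1 ≤ p) {t : ℝ} (ht0 : 0 < t) (ht1 : t < 1) :
    ∏' j : ℕ, (1 - t ^ ((j + 1) ^ p))⁻¹ = Real.exp (realSum powCoeff (powExponent p) t) := by
  have hs := (convergesOnDisc_powCoeff hp).hasSum_real ht0 ht1
  have hlt : ∀ j : ℕ, t ^ ((j + 1) ^ p) < 1 := fun j => pow_lt_one₀ ht0.le ht1 (by positivity)
  have hfib : ∀ j : ℕ, HasSum (fun m => powCoeff (j, m) * t ^ powExponent p (j, m))
      (-Real.log (1 - t ^ ((j + 1) ^ p))) := fun j => by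
    refine (Real.hasSum_pow_div_log_of_abs_lt_one (x := t ^ ((j + 1) ^ p)) ?_).congr_fun ?_
    · rw [abs_of_pos (by positivity)]; exact hlt j
    · intro m
      rw [powCoeff, powExponent, mul_comm (m + 1), pow_mul]
      ring
  rw [realSum, ← (hs.prod_fiberwise hfib).rexp.tprod_eq]
  refine tprod_congr fun j => ?_
  rw [Function.comp_apply, Real.exp_neg, Real.exp_log (sub_pos.2 (hlt j))]

lemma expSum_eq_exp_powCoeff {p : ℕ} (hp : 1 ≤ p) {a : ℕ → ℝ}
    (ha : ∀ t : ℝ, 0 < t → t < 1 →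
      HasSum (fun n : ℕ => a n * t ^ n) (∏' j : ℕ, (1 - t ^ ((j + 1) ^ p))⁻¹))
    (haK : ConvergesOnDisc a fun k => k) {z : ℂ} (hz : ‖z‖ < 1) :
    expSum a (fun k => k) z = Complex.exp (expSum powCoeff (powExponent p) z) := by
  refine expSum_eq_exp_of_real haK (convergesOnDisc_powCoeff hp) (fun t ht0 ht1 => ?_) hz
  rw [expSum_ofReal, expSum_ofReal, (ha t ht0 ht1).tsum_eq, tprod_eq_exp_realSum hp ht0 ht1,
    Complex.ofReal_exp]
  rfl

lemma hasSum_succ_mul_pow {q : ℝ} (hq0 : 0 < q) (hq1 : q < 1) :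
    HasSum (fun m : ℕ => ((m : ℝ) + 1) * q ^ (m + 1)) (q / (1 - q) ^ 2) := by
  have h := hasSum_coe_mul_geometric_of_norm_lt_one (𝕜 := ℝ) (r := q)
    (by rwa [Real.norm_eq_abs, abs_of_pos hq0])
  rw [← hasSum_nat_add_iff' 1] at h
  simpa using h

lemma tsum_succ_sq_mul_pow_le {q : ℝ} (hq0 : 0 < q) (hq1 : q < 1) :
    ∑' m : ℕ, ((m : ℝ) + 1) ^ 2 * q ^ (m + 1) ≤ 2 * q / (1 - q) ^ 3 := by
  have h := (hasSum_choose_mul_geometric_of_norm_lt_one (𝕜 := ℝ) 2 (r := q)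
    (by rwa [Real.norm_eq_abs, abs_of_pos hq0])).mul_left (2 * q)
  have hle : ∀ m : ℕ, ((m : ℝ) + 1) ^ 2 * q ^ (m + 1) ≤
      2 * q * (((m + 2).choose 2 : ℕ) * q ^ m) := fun m => by
    rw [Nat.cast_choose_two]
    push_cast
    have : 0 ≤ q ^ (m + 1) * ((m : ℝ) + 1) := by positivity
    calc _ ≤ ((m : ℝ) + 1) ^ 2 * q ^ (m + 1) + q ^ (m + 1) * ((m : ℝ) + 1) := by linarith
      _ = _ := by ring
  have hsum := Summable.of_nonneg_of_le (fun m => by positivity) hle h.summable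
  refine (hasSum_le hle hsum.hasSum h).trans_eq ?_
  ring

lemma exp_neg_le_sq_mul_tsum {x : ℝ} (hx : 0 < x) :
    Real.exp (-x) ≤ x ^ 2 * ∑' m : ℕ, ((m : ℝ) + 1) * Real.exp (-x) ^ (m + 1) := by
  have hq1 : Real.exp (-x) < 1 := by simpa using hx
  rw [(hasSum_succ_mul_pow (Real.exp_pos _) hq1).tsum_eq, ← mul_div_assoc,
    le_div_iff₀ (pow_pos (sub_pos.2 hq1) 2), mul_comm]
  gcongr
  linarith [Real.add_one_le_exp (-x)]

lemma cube_mul_tsum_le {x : ℝ} (hx : 0 < x) :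
    x ^ 3 * ∑' m : ℕ, ((m : ℝ) + 1) ^ 2 * Real.exp (-x) ^ (m + 1) ≤
      432 * Real.exp (-(x / 2)) := by
  have hq1 : Real.exp (-x) < 1 := by simpa using hx
  have hd : 0 < 1 - Real.exp (-x) := sub_pos.2 hq1
  have hx1 : x ≤ (1 + x) * (1 - Real.exp (-x)) := by
    have h1 : Real.exp (-x) * (1 + x) ≤ 1 := by
      calc Real.exp (-x) * (1 + x) ≤ Real.exp (-x) * Real.exp x := by
            gcongr; linarith [Real.add_one_le_exp x]
        _ = 1 := by rw [← Real.exp_add]; simp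
    linarith
  have hx2 : 1 + x ≤ 6 * Real.exp (x / 6) := by linarith [Real.add_one_le_exp (x / 6)]
  calc _ ≤ x ^ 3 * (2 * Real.exp (-x) / (1 - Real.exp (-x)) ^ 3) := by
        gcongr
        exact tsum_succ_sq_mul_pow_le (Real.exp_pos _) hq1
    _ ≤ ((1 + x) * (1 - Real.exp (-x))) ^ 3 * (2 * Real.exp (-x) / (1 - Real.exp (-x)) ^ 3) := by
        gcongr
    _ = 2 * (1 + x) ^ 3 * Real.exp (-x) := by field_simp
    _ ≤ 2 * (6 * Real.exp (x / 6)) ^ 3 * Real.exp (-x) := by gcongr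
    _ = 432 * (Real.exp (x / 6) ^ 3 * Real.exp (-x)) := by ring
    _ = 432 * Real.exp (-(x / 2)) := by
        rw [← Real.exp_nat_mul, ← Real.exp_add]
        congr 2
        push_cast
        ring

lemma tsum_exp_neg_pow_le {p J : ℕ} (hp : 1 ≤ p) (hJ : 1 ≤ J) {s : ℝ} (hs : 0 < s)
    (hsJ : 1 ≤ s * ((J : ℝ) + 1) ^ p) :
    Summable (fun j : ℕ => Real.exp (-(s * ((j : ℝ) + 1) ^ p / 2))) ∧
      ∑' j : ℕ, Real.exp (-(s * ((j : ℝ) + 1) ^ p / 2)) ≤ 10 * J := by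
  have hJ' : (1 : ℝ) ≤ J := by exact_mod_cast hJ
  have hJ0 : (0 : ℝ) < J := by linarith
  set y : ℝ := 1 / (4 * J) with hy
  have hy0 : 0 < y := by positivity
  have hr1 : Real.exp (-y) < 1 := by simpa using hy0
  have hgeom := (hasSum_geometric_of_lt_one (Real.exp_pos _).le hr1).mul_left (Real.exp (1 / 2))
  have hle : ∀ j : ℕ, Real.exp (-(s * ((j : ℝ) + 1) ^ p / 2)) ≤
      Real.exp (1 / 2) * Real.exp (-y) ^ j := fun j => by
    rw [← Real.exp_nat_mul, ← Real.exp_add, Real.exp_le_exp]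
    set u : ℝ := ((j : ℝ) + 1) / (2 * J) with hu
    have hu0 : 0 ≤ u := by positivity
    have hup : u - 1 ≤ u ^ p := by
      rcases le_total u 1 with h | h
      · linarith [pow_nonneg hu0 p]
      · linarith [le_self_pow₀ h (show p ≠ 0 by omega)]
    have hsu : u ^ p ≤ s * ((j : ℝ) + 1) ^ p := by
      have h1 : 1 ≤ s * (2 * J) ^ p := hsJ.trans (by gcongr; linarith)
      rw [hu, div_pow, div_le_iff₀ (by positivity)]
      have : 0 ≤ ((j : ℝ) + 1) ^ p := by positivity
      nlinarith
    have huy : u / 2 = j * y + y := by rw [hu, hy]; field_simp; ring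
    linarith
  have hsum := Summable.of_nonneg_of_le (fun j => (Real.exp_pos _).le) hle hgeom.summable
  refine ⟨hsum, (hasSum_le hle hsum.hasSum hgeom).trans ?_⟩
  have he : Real.exp (1 / 2) ≤ 2 := by
    have h1 : Real.exp (1 / 2) ^ 2 = Real.exp 1 := by rw [← Real.exp_nat_mul]; norm_num
    nlinarith [Real.exp_one_lt_d9, Real.exp_pos (1 / 2)]
  have hinv : (1 - Real.exp (-y))⁻¹ ≤ 5 * J := by
    rw [inv_le_comm₀ (sub_pos.2 hr1) (by positivity)]
    have h1 : Real.exp (-y) * (1 + y) ≤ 1 := by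
      calc Real.exp (-y) * (1 + y) ≤ Real.exp (-y) * Real.exp y := by
            gcongr; linarith [Real.add_one_le_exp y]
        _ = 1 := by rw [← Real.exp_add]; simp
    have h2 : Real.exp (-y) ≤ 1 / (1 + y) := by rwa [le_div_iff₀ (by positivity)]
    have h3 : (5 * (J : ℝ))⁻¹ ≤ 1 - 1 / (1 + y) := by
      have : 1 - 1 / (1 + y) = 1 / (4 * J + 1) := by rw [hy]; field_simp; ring
      rw [this, inv_eq_one_div]
      gcongr
      linarith
    linarith
  calc _ ≤ 2 * (5 * (J : ℝ)) := by gcongr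
    _ = 10 * J := by ring

lemma secondSum_powCoeff_ge {p J : ℕ} (hp : 1 ≤ p) {s : ℝ} (hs : 0 < s)
    (hsJ : s * (J : ℝ) ^ p ≤ 1) :
    J / (4 * s ^ 2) ≤ secondSum powCoeff (powExponent p) (Real.exp (-s)) := by
  have ht1 : Real.exp (-s) < 1 := by simpa using hs
  have hsum := ((convergesOnDisc_powCoeff hp).eulerCoeff.eulerCoeff.hasSum_real
    (Real.exp_pos _) ht1).summable
  have hinner : ∀ j : ℕ, ∑' m : ℕ, eulerCoeff (eulerCoeff powCoeff (powExponent p))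
      (powExponent p) (j, m) * Real.exp (-s) ^ powExponent p (j, m) =
      (((j : ℝ) + 1) ^ p) ^ 2 *
        ∑' m : ℕ, ((m : ℝ) + 1) * Real.exp (-(s * ((j : ℝ) + 1) ^ p)) ^ (m + 1) := fun j => by
    rw [← tsum_mul_left]
    refine tsum_congr fun m => ?_
    have hm : (m : ℝ) + 1 ≠ 0 := by positivity
    simp only [eulerCoeff, powCoeff, powExponent]
    rw [← Real.exp_nat_mul, ← Real.exp_nat_mul]
    push_cast
    have : ((m : ℝ) + 1) * ((j : ℝ) + 1) ^ p * -s =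
      ((m : ℝ) + 1) * -(s * ((j : ℝ) + 1) ^ p) := by ring
    rw [this]
    field_simp
  have hge : ∀ j ∈ Finset.range J, 1 / (4 * s ^ 2) ≤
      ∑' m : ℕ, eulerCoeff (eulerCoeff powCoeff (powExponent p))
        (powExponent p) (j, m) * Real.exp (-s) ^ powExponent p (j, m) := fun j hj => by
    have hjJ : (j : ℝ) + 1 ≤ J := by exact_mod_cast Finset.mem_range.1 hj
    have hx1 : s * ((j : ℝ) + 1) ^ p ≤ 1 := le_trans (by gcongr) hsJ
    have h1 := exp_neg_le_sq_mul_tsum (x := s * ((j : ℝ) + 1) ^ p) (by positivity)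
    have h2 : (1 : ℝ) / 4 ≤ Real.exp (-(s * ((j : ℝ) + 1) ^ p)) := by
      calc (1 : ℝ) / 4 ≤ Real.exp (-1) := by
            rw [Real.exp_neg, inv_eq_one_div]
            exact one_div_le_one_div_of_le (Real.exp_pos 1) (by linarith [Real.exp_one_lt_d9])
        _ ≤ _ := Real.exp_le_exp.2 (by linarith)
    rw [hinner, div_le_iff₀ (by positivity)]
    rw [mul_pow] at h1
    linarith
  calc (J : ℝ) / (4 * s ^ 2) = ∑ j ∈ Finset.range J, 1 / (4 * s ^ 2) := by
        rw [Finset.sum_const, Finset.card_range, nsmul_eq_mul]; ring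
    _ ≤ _ := Finset.sum_le_sum hge
    _ ≤ _ := hsum.prod.sum_le_tsum _ fun j _ => by rw [hinner]; positivity
    _ = _ := hsum.tsum_prod.symm

lemma thirdSum_powCoeff_le {p J : ℕ} (hp : 1 ≤ p) (hJ : 1 ≤ J) {s : ℝ} (hs : 0 < s)
    (hsJ : 1 ≤ s * ((J : ℝ) + 1) ^ p) :
    thirdSum powCoeff (powExponent p) (Real.exp (-s)) ≤ 4320 * J / s ^ 3 := by
  have ht1 : Real.exp (-s) < 1 := by simpa using hs
  have hsum := ((convergesOnDisc_powCoeff hp).eulerCoeff.eulerCoeff.eulerCoeff.hasSum_real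
    (Real.exp_pos _) ht1).summable
  obtain ⟨hexp, hexple⟩ := tsum_exp_neg_pow_le hp hJ hs hsJ
  have hinner : ∀ j : ℕ, ∑' m : ℕ, eulerCoeff (eulerCoeff (eulerCoeff powCoeff (powExponent p))
      (powExponent p)) (powExponent p) (j, m) * Real.exp (-s) ^ powExponent p (j, m) ≤
      432 / s ^ 3 * Real.exp (-(s * ((j : ℝ) + 1) ^ p / 2)) := fun j => by
    have heq : ∑' m : ℕ, eulerCoeff (eulerCoeff (eulerCoeff powCoeff (powExponent p))
        (powExponent p)) (powExponent p) (j, m) * Real.exp (-s) ^ powExponent p (j, m) =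
        (((j : ℝ) + 1) ^ p) ^ 3 *
          ∑' m : ℕ, ((m : ℝ) + 1) ^ 2 * Real.exp (-(s * ((j : ℝ) + 1) ^ p)) ^ (m + 1) := by
      rw [← tsum_mul_left]
      refine tsum_congr fun m => ?_
      have hm : (m : ℝ) + 1 ≠ 0 := by positivity
      simp only [eulerCoeff, powCoeff, powExponent]
      rw [← Real.exp_nat_mul, ← Real.exp_nat_mul]
      push_cast
      have : ((m : ℝ) + 1) * ((j : ℝ) + 1) ^ p * -s =
        ((m : ℝ) + 1) * -(s * ((j : ℝ) + 1) ^ p) := by ring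
      rw [this]
      field_simp
    have h1 := cube_mul_tsum_le (x := s * ((j : ℝ) + 1) ^ p) (by positivity)
    rw [heq, div_mul_eq_mul_div, le_div_iff₀ (by positivity)]
    rw [mul_pow] at h1
    linarith
  calc thirdSum powCoeff (powExponent p) (Real.exp (-s)) = _ := hsum.tsum_prod
    _ ≤ ∑' j : ℕ, 432 / s ^ 3 * Real.exp (-(s * ((j : ℝ) + 1) ^ p / 2)) :=
        hsum.prod.tsum_le_tsum hinner (hexp.mul_left _)
    _ = 432 / s ^ 3 * ∑' j : ℕ, Real.exp (-(s * ((j : ℝ) + 1) ^ p / 2)) := tsum_mul_left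
    _ ≤ 432 / s ^ 3 * (10 * J) := by gcongr
    _ = 4320 * J / s ^ 3 := by ring

/-- The number of `p`-th powers up to `1 / s`. -/
noncomputable def powCount (p : ℕ) (s : ℝ) : ℕ := ⌊s⁻¹ ^ (p : ℝ)⁻¹⌋₊

lemma mul_powCount_pow_le {p : ℕ} (hp : 1 ≤ p) {s : ℝ} (hs : 0 < s) :
    s * (powCount p s : ℝ) ^ p ≤ 1 := by
  have h : (powCount p s : ℝ) ≤ s⁻¹ ^ (p : ℝ)⁻¹ := Nat.floor_le (by positivity)
  calc s * (powCount p s : ℝ) ^ p ≤ s * (s⁻¹ ^ (p : ℝ)⁻¹) ^ p := by gcongr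
    _ = 1 := by
      rw [Real.rpow_inv_natCast_pow (by positivity) (by omega), mul_inv_cancel₀ hs.ne']

lemma one_le_mul_powCount_succ_pow {p : ℕ} (hp : 1 ≤ p) {s : ℝ} (hs : 0 < s) :
    1 ≤ s * ((powCount p s : ℝ) + 1) ^ p := by
  have h : s⁻¹ ^ (p : ℝ)⁻¹ ≤ (powCount p s : ℝ) + 1 := (Nat.lt_floor_add_one _).le
  calc 1 = s * (s⁻¹ ^ (p : ℝ)⁻¹) ^ p := by
        rw [Real.rpow_inv_natCast_pow (by positivity) (by omega), mul_inv_cancel₀ hs.ne']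
    _ ≤ _ := by gcongr

lemma tendsto_powCount {p : ℕ} (hp : 1 ≤ p) :
    Tendsto (fun t : ℝ => powCount p (-Real.log t)) (𝓝[<] 1) atTop := by
  have hlog : Tendsto (fun t : ℝ => -Real.log t) (𝓝[<] 1) (𝓝[>] 0) := by
    rw [tendsto_nhdsWithin_iff]
    refine ⟨?_, ?_⟩
    · have : Tendsto (fun t : ℝ => -Real.log t) (𝓝 1) (𝓝 0) := by
        simpa using (Real.continuousAt_log one_ne_zero).tendsto.neg
      exact this.mono_left nhdsWithin_le_nhds
    · filter_upwards [Ioo_mem_nhdsLT (show (0 : ℝ) < 1 by norm_num)] with t ht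
      exact neg_pos.2 (Real.log_neg ht.1 ht.2)
  exact tendsto_nat_floor_atTop.comp ((tendsto_rpow_atTop (by positivity)).comp
    (tendsto_inv_nhdsGT_zero.comp hlog))

lemma thirdSum_div_le {p J : ℕ} (hp : 1 ≤ p) (hJ : 1 ≤ J) {s : ℝ} (hs : 0 < s)
    (hsJ : s * (J : ℝ) ^ p ≤ 1) (hsJ' : 1 ≤ s * ((J : ℝ) + 1) ^ p) :
    thirdSum powCoeff (powExponent p) (Real.exp (-s)) /
      Real.sqrt (secondSum powCoeff (powExponent p) (Real.exp (-s))) ^ 3 ≤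
      34560 / Real.sqrt J := by
  have hJ0 : (0 : ℝ) < J := by exact_mod_cast hJ
  have hroot : Real.sqrt J / (2 * s) ≤
      Real.sqrt (secondSum powCoeff (powExponent p) (Real.exp (-s))) := by
    refine Real.le_sqrt_of_sq_le (le_trans (le_of_eq ?_) (secondSum_powCoeff_ge hp hs hsJ))
    rw [div_pow, Real.sq_sqrt hJ0.le]
    ring
  have hsq : 0 < Real.sqrt J := Real.sqrt_pos.2 hJ0
  calc _ ≤ (4320 * J / s ^ 3) / (Real.sqrt J / (2 * s)) ^ 3 := by
        gcongr
        exact thirdSum_powCoeff_le hp hJ hs hsJ'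
    _ = 34560 / Real.sqrt J := by
        nth_rewrite 1 [← Real.sq_sqrt hJ0.le]
        field_simp
        norm_num

end PowerPartitions

/-- the OGF `G_p(z) = ∏_{j≥1} (1 - z^{j^p})⁻¹` of partitions into `p`-th
powers (whose coefficients `a` are characterized by the product identity on `(0,1)`)
is Gaussian. -/
theorem statement12 (p : ℕ) (hp : 1 ≤ p) (a : ℕ → ℝ)
    (ha : ∀ t : ℝ, 0 < t → t < 1 →
      HasSum (fun n : ℕ => a n * t ^ n) (∏' j : ℕ, (1 - t ^ ((j + 1) ^ p))⁻¹)) :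
    IsGaussian a 1 := by
  have haK : ConvergesOnDisc a fun k => k := fun t ht0 ht1 =>
    (ha t ht0 ht1).summable.abs.congr fun k => by
      rw [abs_mul, abs_of_pos (pow_pos ht0 k)]
  have hcount := tendsto_powCount hp
  have hev : ∀ᶠ t : ℝ in 𝓝[<] 1, 0 < -Real.log t ∧ Real.exp (-(-Real.log t)) = t := by
    filter_upwards [Ioo_mem_nhdsLT (show (0 : ℝ) < 1 by norm_num)] with t ht
    exact ⟨neg_pos.2 (Real.log_neg ht.1 ht.2), by rw [neg_neg, Real.exp_log ht.1]⟩
  have hthird : ∀ t : ℝ, 0 < t → 0 ≤ thirdSum powCoeff (powExponent p) t := fun t ht =>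
    tsum_nonneg fun i => by
      have := powCoeff_nonneg i
      simp only [eulerCoeff]
      positivity
  refine isGaussian_of_eq_exp haK (convergesOnDisc_powCoeff hp) powCoeff_nonneg
    (fun z hz => expSum_eq_exp_powCoeff hp ha haK hz) ?_ ?_
  · filter_upwards [hev, hcount.eventually_ge_atTop 1] with t ⟨hs, ht⟩ hJ
    have h := secondSum_powCoeff_ge hp hs (mul_powCount_pow_le hp hs)
    rw [ht] at h
    have hJ0 : (0 : ℝ) < powCount p (-Real.log t) := by exact_mod_cast hJ
    exact lt_of_lt_of_le (by positivity) h
  · have hlim : Tendsto (fun t : ℝ => 34560 / Real.sqrt (powCount p (-Real.log t)))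
        (𝓝[<] 1) (𝓝 0) :=
      (Real.tendsto_sqrt_atTop.comp (tendsto_natCast_atTop_atTop.comp hcount)).const_div_atTop _
    refine squeeze_zero' ?_ ?_ hlim
    · filter_upwards [hev] with t ⟨_, ht⟩
      exact div_nonneg (hthird t (ht ▸ Real.exp_pos _)) (by positivity)
    · filter_upwards [hev, hcount.eventually_ge_atTop 1] with t ⟨hs, ht⟩ hJ
      have h := thirdSum_div_le hp hJ hs (mul_powCount_pow_le hp hs)
        (one_le_mul_powCount_succ_pow hp hs)
      rwa [ht] at h

end KhinchinPaper
end

section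
/- The MacMahon function M(z) = ∏_{j=1}^{∞} (1 − z^j)^{−j}, the ordinary generating function of plane partitions (a power series in 𝒦 with radius of convergence 1), is Gaussian: its normalized Khinchin family X̆_t converges in distribution to the standard normal N(0,1) as t ↑ 1. -/
open scoped BigOperators Topology
open Filter

namespace KhinchinPaper

theorem summable_pow_mul_abs_mul_pow {c : ℕ → ℝ}
    (hc : ∀ t : ℝ, 0 < t → t < 1 → Summable fun n => c n * t ^ n) (k : ℕ) {t : ℝ}
    (ht₀ : 0 ≤ t) (ht₁ : t < 1) : Summable fun n : ℕ => (n : ℝ) ^ k * |c n| * t ^ n := by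
  obtain ⟨r, htr, hr₁⟩ := exists_between ht₁
  have hr₀ : 0 < r := ht₀.trans_lt htr
  obtain ⟨M, hM⟩ := (hc r hr₀ hr₁).tendsto_atTop_zero.abs.bddAbove_range
  have hq : ‖t / r‖ < 1 := by
    rw [Real.norm_of_nonneg (by positivity), div_lt_one hr₀]; exact htr
  refine Summable.of_nonneg_of_le (fun n => by positivity) (fun n => ?_)
    ((summable_pow_mul_geometric_of_norm_lt_one k hq).mul_left M)
  have h : |c n| * r ^ n ≤ M := by
    simpa [abs_mul, abs_of_pos hr₀] using hM ⟨n, rfl⟩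
  calc (n : ℝ) ^ k * |c n| * t ^ n
      = (|c n| * r ^ n) * ((n : ℝ) ^ k * (t / r) ^ n) := by
        rw [div_pow]; field_simp
    _ ≤ M * ((n : ℝ) ^ k * (t / r) ^ n) := by gcongr

theorem summable_natCast_mul {c : ℕ → ℝ}
    (hc : ∀ t : ℝ, 0 < t → t < 1 → Summable fun n => c n * t ^ n) (t : ℝ)
    (ht₀ : 0 < t) (ht₁ : t < 1) : Summable fun n : ℕ => (n * c n) * t ^ n := by
  refine Summable.of_norm_bounded (summable_pow_mul_abs_mul_pow hc 1 ht₀.le ht₁) fun n => ?_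
  simp [abs_of_pos ht₀]

theorem hasDerivAt_fsum {c : ℕ → ℝ}
    (hc : ∀ t : ℝ, 0 < t → t < 1 → Summable fun n => c n * t ^ n) {t : ℝ}
    (ht₀ : 0 < t) (ht₁ : t < 1) :
    HasDerivAt (fsum c) (fsum (fun n => n * c n) t / t) t := by
  obtain ⟨r, htr, hr₁⟩ := exists_between ht₁
  have hr₀ : 0 < r := ht₀.trans htr
  have hderiv := hasDerivAt_tsum_of_isPreconnected (𝕜 := ℝ) (F := ℝ)
    (u := fun n : ℕ => ((n : ℝ) ^ 1 * |c n| * r ^ n) / r)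
    (g := fun n x => c n * x ^ n) (g' := fun n x => c n * (n * x ^ (n - 1)))
    (t := Set.Ioo 0 r) (y₀ := t) (y := t)
    ((summable_pow_mul_abs_mul_pow hc 1 hr₀.le hr₁).div_const r) isOpen_Ioo isPreconnected_Ioo
    (fun n x _ => (hasDerivAt_pow n x).const_mul (c n)) ?_ ⟨ht₀, htr⟩ (hc t ht₀ ht₁) ⟨ht₀, htr⟩
  · refine hderiv.congr_deriv ?_
    simp only [fsum]
    rw [← tsum_div_const]
    refine tsum_congr fun n => ?_
    rcases n with _ | n
    · simp
    · rw [Nat.add_sub_cancel, pow_succ]; field_simp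
  · rintro n x ⟨hx₀, hxr⟩
    rcases n with _ | n
    · simp
    · rw [Nat.add_sub_cancel, Real.norm_eq_abs, abs_mul, abs_mul, abs_of_pos (pow_pos hx₀ n),
        Nat.abs_cast, pow_succ r n]
      have : x ^ n ≤ r ^ n := by gcongr
      calc |c (n + 1)| * (((n + 1 : ℕ) : ℝ) * x ^ n)
          ≤ |c (n + 1)| * (((n + 1 : ℕ) : ℝ) * r ^ n) := by
            gcongr
        _ = _ := by field_simp

theorem moments_of_fsum_eq_exp {a b : ℕ → ℝ}
    (ha : ∀ t : ℝ, 0 < t → t < 1 → Summable fun n => a n * t ^ n)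
    (hb : ∀ t : ℝ, 0 < t → t < 1 → Summable fun n => b n * t ^ n)
    (hab : ∀ t : ℝ, 0 < t → t < 1 → fsum a t = Real.exp (fsum b t)) {t : ℝ}
    (ht₀ : 0 < t) (ht₁ : t < 1) :
    mf a t = fsum (fun n => n * b n) t ∧ sigma2 a t = fsum (fun n => n * (n * b n)) t := by
  have h₁ : ∀ s : ℝ, 0 < s → s < 1 →
      fsum (fun n => n * a n) s = fsum a s * fsum (fun n => n * b n) s := by
    intro s hs₀ hs₁
    have hd := (hasDerivAt_fsum hb hs₀ hs₁).exp
    have he : fsum a =ᶠ[𝓝 s] fun x => Real.exp (fsum b x) := by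
      filter_upwards [Ioo_mem_nhds hs₀ hs₁] with x hx using hab x hx.1 hx.2
    have hu := (hasDerivAt_fsum ha hs₀ hs₁).unique (hd.congr_of_eventuallyEq he)
    rw [← hab s hs₀ hs₁] at hu
    field_simp at hu
    exact hu
  have h₂ : fsum (fun n => n * (n * a n)) t =
      fsum a t * (fsum (fun n => n * b n) t ^ 2 + fsum (fun n => n * (n * b n)) t) := by
    have hd := (hasDerivAt_fsum ha ht₀ ht₁).mul
      (hasDerivAt_fsum (summable_natCast_mul hb) ht₀ ht₁)
    have he : fsum (fun n => n * a n) =ᶠ[𝓝 t] fsum a * fsum (fun n => n * b n) := by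
      filter_upwards [Ioo_mem_nhds ht₀ ht₁] with x hx using h₁ x hx.1 hx.2
    have hu := (hasDerivAt_fsum (summable_natCast_mul ha) ht₀ ht₁).unique
      (hd.congr_of_eventuallyEq he)
    rw [h₁ t ht₀ ht₁] at hu
    rw [div_mul_eq_mul_div, mul_div_assoc', ← add_div, div_left_inj' ht₀.ne'] at hu
    linear_combination hu
  have hf : fsum a t ≠ 0 := by rw [hab t ht₀ ht₁]; exact Real.exp_ne_zero _
  have hm : mf a t = fsum (fun n => n * b n) t := by
    have := h₁ t ht₀ ht₁
    rw [mf, div_eq_iff hf, mul_comm _ (fsum a t), ← this]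
    rfl
  refine ⟨hm, ?_⟩
  have h₃ : ∑' n : ℕ, (n : ℝ) ^ 2 * a n * t ^ n = fsum (fun n => n * (n * a n)) t :=
    tsum_congr fun n => by ring
  rw [sigma2, h₃, h₂, hm]
  field_simp
  ring

theorem differentiableOn_fsumC {c : ℕ → ℝ}
    (hc : ∀ t : ℝ, 0 < t → t < 1 → Summable fun n => c n * t ^ n) :
    DifferentiableOn ℂ (fsumC c) (Metric.ball 0 1) := by
  intro z hz
  rw [mem_ball_zero_iff] at hz
  obtain ⟨r, hzr, hr₁⟩ := exists_between hz
  have hr₀ : 0 < r := (norm_nonneg z).trans_lt hzr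
  refine DifferentiableAt.differentiableWithinAt ?_
  have hsum := summable_pow_mul_abs_mul_pow hc 0 hr₀.le hr₁
  have hd : DifferentiableOn ℂ (fsumC c) (Metric.ball 0 r) := by
    refine Complex.differentiableOn_tsum_of_summable_norm hsum
      (fun n => ((differentiable_id.pow n).const_mul _).differentiableOn) Metric.isOpen_ball
      fun n w hw => ?_
    rw [mem_ball_zero_iff] at hw
    have : ‖w‖ ^ n ≤ r ^ n := by gcongr
    simp only [norm_mul, norm_pow, Complex.norm_real, Real.norm_eq_abs, pow_zero, one_mul]
    gcongr
  exact hd.differentiableAt (Metric.isOpen_ball.mem_nhds (by simpa using hzr))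

theorem fsumC_ofReal (c : ℕ → ℝ) (t : ℝ) : fsumC c t = (fsum c t : ℂ) := by
  rw [fsumC, fsum, Complex.ofReal_tsum]
  exact tsum_congr fun n => by push_cast; rfl

theorem fsumC_eq_exp {a b : ℕ → ℝ}
    (ha : ∀ t : ℝ, 0 < t → t < 1 → Summable fun n => a n * t ^ n)
    (hb : ∀ t : ℝ, 0 < t → t < 1 → Summable fun n => b n * t ^ n)
    (hab : ∀ t : ℝ, 0 < t → t < 1 → fsum a t = Real.exp (fsum b t)) {z : ℂ} (hz : ‖z‖ < 1) :
    fsumC a z = Complex.exp (fsumC b z) := by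
  have hA := (differentiableOn_fsumC ha).analyticOnNhd Metric.isOpen_ball
  have hB := (differentiableOn_fsumC hb).cexp.analyticOnNhd Metric.isOpen_ball
  refine hA.eqOn_of_preconnected_of_frequently_eq hB (convex_ball 0 1).isPreconnected
    (z₀ := ((1 / 2 : ℝ) : ℂ)) ?_ ?_ (by simpa using hz)
  · rw [mem_ball_zero_iff, Complex.norm_real]; norm_num
  · have ht : Tendsto (fun x : ℝ => (x : ℂ)) (𝓝[≠] (1 / 2)) (𝓝[≠] ((1 / 2 : ℝ) : ℂ)) :=
      tendsto_nhdsWithin_iff.2 ⟨(Complex.continuous_ofReal.tendsto _).mono_left nhdsWithin_le_nhds,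
        by filter_upwards [self_mem_nhdsWithin] with x hx using
          fun h => hx (Complex.ofReal_injective h)⟩
    refine ht.frequently (Eventually.frequently ?_)
    filter_upwards [nhdsWithin_le_nhds (Ioo_mem_nhds (a := (0 : ℝ)) (b := 1) (by norm_num)
      (by norm_num : (1 / 2 : ℝ) < 1))] with x hx
    rw [fsumC_ofReal, fsumC_ofReal, hab x hx.1 hx.2, Complex.ofReal_exp]

theorem norm_exp_I_mul_sub_taylor_le (x : ℝ) :
    ‖Complex.exp (Complex.I * x) - 1 - Complex.I * x + x ^ 2 / 2‖ ≤ 4 * |x| ^ 3 := by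
  rcases le_total |x| 1 with hx | hx
  · have h := Complex.exp_bound (x := Complex.I * x) (by simpa using hx) (n := 3) (by norm_num)
    have hs : ∑ m ∈ Finset.range 3, (Complex.I * x) ^ m / (m.factorial : ℂ) =
        1 + Complex.I * x - x ^ 2 / 2 := by
      simp only [Finset.sum_range_succ, Finset.sum_range_zero, mul_pow, Complex.I_sq, Nat.factorial]
      push_cast; ring
    rw [hs] at h
    simp only [norm_mul, Complex.norm_I, one_mul, Complex.norm_real, Real.norm_eq_abs] at h
    calc _ = _ := by congr 1; ring
      _ ≤ _ := h
      _ ≤ 4 * |x| ^ 3 := by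
        norm_num [Nat.factorial]
        nlinarith [pow_nonneg (abs_nonneg x) 3]
  · have h₁ : ‖Complex.exp (Complex.I * x)‖ = 1 := by
      rw [mul_comm]; exact Complex.norm_exp_ofReal_mul_I x
    have h₂ : ‖Complex.I * x‖ = |x| := by simp
    have h₃ : ‖(x : ℂ) ^ 2 / 2‖ = |x| ^ 2 / 2 := by simp
    have h₄ := norm_add_le (Complex.exp (Complex.I * x) - 1 - Complex.I * x) ((x : ℂ) ^ 2 / 2)
    have h₅ := norm_sub_le (Complex.exp (Complex.I * x) - 1) (Complex.I * x)
    have h₆ := norm_sub_le (Complex.exp (Complex.I * x)) 1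
    rw [norm_one] at h₆
    have h₇ : 1 ≤ |x| ^ 3 := one_le_pow₀ hx
    have h₈ : |x| ≤ |x| ^ 3 := le_self_pow₀ hx (by norm_num)
    have h₉ : |x| ^ 2 ≤ |x| ^ 3 := pow_le_pow_right₀ hx (by norm_num)
    linarith

theorem charfun_eq_exp {a b : ℕ → ℝ}
    (ha : ∀ t : ℝ, 0 < t → t < 1 → Summable fun n => a n * t ^ n)
    (hb : ∀ t : ℝ, 0 < t → t < 1 → Summable fun n => b n * t ^ n)
    (hab : ∀ t : ℝ, 0 < t → t < 1 → fsum a t = Real.exp (fsum b t)) {t : ℝ}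
    (ht₀ : 0 < t) (ht₁ : t < 1) (θ : ℝ) :
    charfun a t θ = Complex.exp (∑' n : ℕ, ((b n * t ^ n : ℝ) : ℂ) *
      (Complex.exp (Complex.I * ((n * (θ / sigma a t) : ℝ) : ℂ)) - 1 -
        Complex.I * ((n * (θ / sigma a t) : ℝ) : ℂ))) := by
  set φ := θ / sigma a t with hφ
  set z : ℂ := t * Complex.exp (Complex.I * φ) with hz
  have hnz : ‖z‖ = t := by
    rw [hz, norm_mul, mul_comm Complex.I, Complex.norm_exp_ofReal_mul_I, Complex.norm_real,
      Real.norm_of_nonneg ht₀.le, mul_one]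
  have hzn : ∀ n : ℕ, z ^ n = (t : ℂ) ^ n * Complex.exp (Complex.I * ((n * φ : ℝ) : ℂ)) := by
    intro n
    rw [hz, mul_pow, ← Complex.exp_nat_mul]
    push_cast
    ring_nf
  have hchar : charfun a t θ =
      Complex.exp (-(Complex.I * φ * mf a t)) * fsumC a z / fsum a t := by
    rw [charfun, fsumC, ← tsum_mul_left, ← tsum_div_const]
    refine tsum_congr fun n => ?_
    have he : Complex.I * (θ : ℂ) * ((((n : ℝ) - mf a t) / sigma a t : ℝ) : ℂ) =
        -(Complex.I * φ * mf a t) + Complex.I * ((n * φ : ℝ) : ℂ) := by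
      rw [hφ]; push_cast; ring
    rw [he, Complex.exp_add, hzn]
    push_cast
    ring
  have hsz : Summable fun n => (b n : ℂ) * z ^ n := by
    refine Summable.of_norm_bounded (summable_pow_mul_abs_mul_pow hb 0 ht₀.le ht₁) fun n => ?_
    simp [hnz]
  have hst : Summable fun n => (b n : ℂ) * (t : ℂ) ^ n := by
    exact_mod_cast Complex.summable_ofReal.2 (hb t ht₀ ht₁)
  have hsm : Summable fun n : ℕ => Complex.I * φ * ((((n : ℝ) * b n) * t ^ n : ℝ) : ℂ) :=
    (Complex.summable_ofReal.2 (summable_natCast_mul hb t ht₀ ht₁)).mul_left _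
  have hmean : Complex.I * φ * ((fsum (fun n => n * b n) t : ℝ) : ℂ) =
      ∑' n : ℕ, Complex.I * φ * ((((n : ℝ) * b n) * t ^ n : ℝ) : ℂ) := by
    rw [fsum, Complex.ofReal_tsum, tsum_mul_left]
  rw [hchar, fsumC_eq_exp ha hb hab (hnz.trans_lt ht₁), hab t ht₀ ht₁,
    (moments_of_fsum_eq_exp ha hb hab ht₀ ht₁).1, Complex.ofReal_exp, ← Complex.exp_add,
    ← Complex.exp_sub, ← fsumC_ofReal b t, hmean, fsumC, fsumC]
  congr 1
  rw [neg_add_eq_sub, sub_sub, add_comm (tsum _), ← sub_sub, ← hsz.tsum_sub hst,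
    ← (hsz.sub hst).tsum_sub hsm]
  refine tsum_congr fun n => ?_
  rw [hzn]
  push_cast
  ring

theorem isGaussian_of_fsum_eq_exp {a b : ℕ → ℝ}
    (ha : ∀ t : ℝ, 0 < t → t < 1 → Summable fun n => a n * t ^ n)
    (hb : ∀ t : ℝ, 0 < t → t < 1 → Summable fun n => b n * t ^ n)
    (hab : ∀ t : ℝ, 0 < t → t < 1 → fsum a t = Real.exp (fsum b t))
    (hb₀ : ∀ n, 0 ≤ b n)
    (hpos : ∀ᶠ t in 𝓝[<] (1 : ℝ), 0 < sigma2 a t)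
    (hlim : Tendsto (fun t => fsum (fun n => (n : ℝ) ^ 3 * b n) t / sigma a t ^ 3)
      (𝓝[<] 1) (𝓝 0)) :
    IsGaussian a 1 := by
  intro θ
  set E : ℝ → ℂ := fun t => ∑' n : ℕ, ((b n * t ^ n : ℝ) : ℂ) *
      (Complex.exp (Complex.I * ((n * (θ / sigma a t) : ℝ) : ℂ)) - 1 -
        Complex.I * ((n * (θ / sigma a t) : ℝ) : ℂ))
  have hunit : ∀ᶠ t in 𝓝[<] (1 : ℝ), t ∈ Set.Ioo (0 : ℝ) 1 :=
    Ioo_mem_nhdsLT zero_lt_one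
  have hbound : ∀ᶠ t in 𝓝[<] (1 : ℝ), ‖E t - (-(θ : ℂ) ^ 2 / 2)‖ ≤
      4 * |θ| ^ 3 * (fsum (fun n => (n : ℝ) ^ 3 * b n) t / sigma a t ^ 3) := by
    filter_upwards [hunit, hpos] with t ⟨ht₀, ht₁⟩ hσ
    have hσ₀ : 0 < sigma a t := Real.sqrt_pos.2 hσ
    have hσ₂ : sigma a t ^ 2 = fsum (fun n => n * (n * b n)) t := by
      rw [sigma, Real.sq_sqrt hσ.le, (moments_of_fsum_eq_exp ha hb hab ht₀ ht₁).2]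
    set φ := θ / sigma a t with hφ
    set e : ℕ → ℂ := fun n => ((b n * t ^ n : ℝ) : ℂ) *
      (Complex.exp (Complex.I * ((n * φ : ℝ) : ℂ)) - 1 - Complex.I * ((n * φ : ℝ) : ℂ) +
        ((n * φ : ℝ) : ℂ) ^ 2 / 2) with he
    have hs₃ : Summable fun n : ℕ => (4 * |φ| ^ 3) * (((n : ℝ) ^ 3 * b n) * t ^ n) := by
      refine Summable.mul_left _ ?_
      simpa only [abs_of_nonneg (hb₀ _)] using summable_pow_mul_abs_mul_pow hb 3 ht₀.le ht₁
    have hen : ∀ n, ‖e n‖ ≤ (4 * |φ| ^ 3) * (((n : ℝ) ^ 3 * b n) * t ^ n) := by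
      intro n
      have h := norm_exp_I_mul_sub_taylor_le (n * φ)
      have hnn : 0 ≤ b n * t ^ n := mul_nonneg (hb₀ n) (by positivity)
      rw [he, norm_mul, Complex.norm_real, Real.norm_of_nonneg hnn]
      calc b n * t ^ n * _ ≤ b n * t ^ n * (4 * |n * φ| ^ 3) := mul_le_mul_of_nonneg_left h hnn
        _ = _ := by rw [abs_mul, Nat.abs_cast]; ring
    have hsq : Summable fun n : ℕ => ((φ ^ 2 / 2 * (((n : ℝ) * (n * b n)) * t ^ n) : ℝ) : ℂ) :=
      Complex.summable_ofReal.2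
        ((summable_natCast_mul (summable_natCast_mul hb) t ht₀ ht₁).mul_left _)
    have hse : Summable e := .of_norm_bounded hs₃ hen
    have hsqv : ∑' n : ℕ, ((φ ^ 2 / 2 * (((n : ℝ) * (n * b n)) * t ^ n) : ℝ) : ℂ) =
        (θ : ℂ) ^ 2 / 2 := by
      rw [← Complex.ofReal_tsum, tsum_mul_left]
      change ((φ ^ 2 / 2 * fsum (fun n => n * (n * b n)) t : ℝ) : ℂ) = _
      rw [← hσ₂, hφ]
      norm_cast
      field_simp
    have hEe : E t - (-(θ : ℂ) ^ 2 / 2) = ∑' n, e n := by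
      rw [neg_div, sub_neg_eq_add, ← eq_sub_iff_add_eq, ← hsqv, ← hse.tsum_sub hsq]
      refine tsum_congr fun n => ?_
      rw [he, hφ]
      push_cast
      ring
    rw [hEe]
    refine (tsum_of_norm_bounded hs₃.hasSum hen).trans_eq ?_
    rw [tsum_mul_left, ← fsum, hφ, abs_div, abs_of_pos hσ₀]
    field_simp
  have hlimE : Tendsto E (𝓝[<] 1) (𝓝 (-(θ : ℂ) ^ 2 / 2)) := by
    rw [tendsto_iff_norm_sub_tendsto_zero]
    exact squeeze_zero' (Eventually.of_forall fun _ => norm_nonneg _) hbound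
      (by simpa using hlim.const_mul (4 * |θ| ^ 3))
  refine ((Complex.continuous_exp.tendsto _).comp hlimE).congr' ?_
  filter_upwards [hunit] with t ht using (charfun_eq_exp ha hb hab ht.1 ht.2 θ).symm

/-- The coefficients of `log M`, that is `∑_{d e = n} d / e`. -/
noncomputable def logCoeff (n : ℕ) : ℝ := ∑ p ∈ n.divisorsAntidiagonal, (p.1 : ℝ) / p.2

theorem logCoeff_nonneg (n : ℕ) : 0 ≤ logCoeff n :=
  Finset.sum_nonneg fun _ _ => by positivity

theorem natCast_le_logCoeff (n : ℕ) : (n : ℝ) ≤ logCoeff n := by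
  rcases eq_or_ne n 0 with rfl | hn
  · simpa using logCoeff_nonneg 0
  · have h : (n, 1) ∈ n.divisorsAntidiagonal := by simp [hn]
    simpa [logCoeff] using Finset.single_le_sum (f := fun p : ℕ × ℕ => (p.1 : ℝ) / p.2)
      (fun _ _ => by positivity) h

theorem logCoeff_le (n : ℕ) : logCoeff n ≤ 2 * n := by
  rw [logCoeff, Nat.sum_divisorsAntidiagonal' (fun d e => (d : ℝ) / e)]
  have hsub : n.divisors ⊆ Finset.Ioo 0 (n + 1) := by
    intro e he
    have := Nat.pos_of_mem_divisors he
    have := Nat.divisor_le he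
    simp only [Finset.mem_Ioo]
    omega
  calc ∑ e ∈ n.divisors, ((n / e : ℕ) : ℝ) / e
      ≤ ∑ e ∈ n.divisors, (n : ℝ) * ((e : ℝ) ^ 2)⁻¹ := by
        refine Finset.sum_le_sum fun e _ => ?_
        calc ((n / e : ℕ) : ℝ) / e ≤ ((n : ℝ) / e) / e := by gcongr; exact Nat.cast_div_le
          _ = _ := by rw [div_div, ← sq, div_eq_mul_inv]
    _ ≤ ∑ e ∈ Finset.Ioo 0 (n + 1), (n : ℝ) * ((e : ℝ) ^ 2)⁻¹ :=
        Finset.sum_le_sum_of_subset_of_nonneg hsub fun _ _ _ => by positivity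
    _ = n * ∑ e ∈ Finset.Ioo 0 (n + 1), ((e : ℝ) ^ 2)⁻¹ := by rw [Finset.mul_sum]
    _ ≤ n * (2 / ((0 : ℕ) + 1)) := by gcongr; exact sum_Ioo_inv_sq_le 0 (n + 1)
    _ = 2 * n := by simp [mul_comm]

theorem summable_logCoeff (t : ℝ) (ht₀ : 0 < t) (ht₁ : t < 1) :
    Summable fun n => logCoeff n * t ^ n := by
  refine Summable.of_nonneg_of_le (fun n => mul_nonneg (logCoeff_nonneg n) (by positivity))
    (fun n => ?_) ((summable_pow_mul_geometric_of_norm_lt_one (R := ℝ) 1 (r := t)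
      (by rwa [Real.norm_of_nonneg ht₀.le])).mul_left 2)
  rw [← mul_assoc, pow_one]
  gcongr
  exact logCoeff_le n

theorem tprod_eq_exp_fsum_logCoeff {t : ℝ} (ht₀ : 0 < t) (ht₁ : t < 1) :
    ∏' j : ℕ, ((1 - t ^ (j + 1)) ^ (j + 1))⁻¹ = Real.exp (fsum logCoeff t) := by
  set g : ℕ+ × ℕ+ → ℝ := fun p => ((p.1 : ℕ) : ℝ) / ((p.2 : ℕ) : ℝ) * t ^ ((p.1 : ℕ) * (p.2 : ℕ))
    with hg
  have hgs : Summable g := by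
    have h := (summable_prod_mul_pow (𝕜 := ℝ) 1 (r := t)
      (by rwa [Real.norm_of_nonneg ht₀.le])).prod_symm
    refine Summable.of_nonneg_of_le (fun p => by positivity) (fun p => ?_) h
    have h₁ : (1 : ℝ) ≤ ((p.2 : ℕ) : ℝ) := by exact_mod_cast p.2.pos
    simp only [Prod.fst_swap, Prod.snd_swap, pow_one, hg]
    rw [mul_comm (p.2 : ℕ)]
    gcongr
    exact div_le_self (by positivity) h₁
  have hfib : HasSum (fun n : ℕ+ => logCoeff n * t ^ (n : ℕ)) (∑' p, g p) := by
    refine ((sigmaAntidiagonalEquivProd.hasSum_iff).2 hgs.hasSum).sigma fun n => ?_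
    rw [logCoeff, Finset.sum_mul, ← Finset.sum_coe_sort]
    convert! hasSum_fintype _ using 1
    refine Finset.sum_congr rfl fun p _ => ?_
    have hp := (Nat.mem_divisorsAntidiagonal.1 p.2).1
    simp only [Function.comp, hg, sigmaAntidiagonalEquivProd, Equiv.coe_fn_mk,
      divisorsAntidiagonalFactors, PNat.mk_coe, hp]
  have hS : ∑' p, g p = fsum logCoeff t := by
    have h := hasSum_pnat_iff_hasSum_succ (f := fun n => logCoeff n * t ^ n).1 hfib
    rw [fsum, (summable_logCoeff t ht₀ ht₁).tsum_eq_zero_add, h.tsum_eq]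
    simp [logCoeff]
  have hlog : HasSum (fun j : ℕ+ => ((j : ℕ) : ℝ) * -Real.log (1 - t ^ (j : ℕ))) (∑' p, g p) := by
    refine hgs.hasSum.prod_fiberwise fun j => ?_
    have hj : |t ^ (j : ℕ)| < 1 := by
      rw [abs_of_nonneg (by positivity)]
      exact pow_lt_one₀ ht₀.le ht₁ j.ne_zero
    refine (hasSum_pnat_iff_hasSum_succ (f := fun k : ℕ =>
      ((j : ℕ) : ℝ) / (k : ℝ) * t ^ ((j : ℕ) * k))).2 ?_
    convert! (Real.hasSum_pow_div_log_of_abs_lt_one hj).mul_left ((j : ℕ) : ℝ) using 2 with k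
    rw [← pow_mul]
    push_cast
    ring
  have hexp := (hasSum_pnat_iff_hasSum_succ
    (f := fun j : ℕ => (j : ℝ) * -Real.log (1 - t ^ j))).1 hlog |>.rexp
  rw [← hS, ← hexp.tprod_eq]
  refine tprod_congr fun j => ?_
  have hj : 0 < 1 - t ^ (j + 1) := sub_pos.2 (pow_lt_one₀ ht₀.le ht₁ j.succ_ne_zero)
  rw [Function.comp, mul_neg, Real.exp_neg, Real.exp_nat_mul, Real.exp_log hj]

theorem fsum_cube_logCoeff_le {t : ℝ} (ht₀ : 0 < t) (ht₁ : t < 1) :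
    fsum (fun n => (n : ℝ) ^ 3 * logCoeff n) t ≤ 48 / (1 - t) ^ 5 := by
  have hc := hasSum_choose_mul_geometric_of_norm_lt_one 4 (r := t)
    (by rwa [Real.norm_of_nonneg ht₀.le])
  have hs : Summable fun n : ℕ => (n : ℝ) ^ 3 * logCoeff n * t ^ n := by
    simpa only [abs_of_nonneg (logCoeff_nonneg _)] using
      summable_pow_mul_abs_mul_pow summable_logCoeff 3 ht₀.le ht₁
  refine (hasSum_le (fun n => ?_) hs.hasSum (hc.mul_left 48)).trans_eq (by ring)
  have h₁ : (n : ℝ) ^ 4 ≤ 24 * ((n + 4).choose 4 : ℝ) := by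
    have h : n ^ 4 ≤ 24 * (n + 4).choose 4 := by
      have h₂ := Nat.ascFactorial_eq_factorial_mul_choose n 4
      have h₃ := Nat.pow_succ_le_ascFactorial (n + 1) 4
      rw [h₂] at h₃
      exact (Nat.pow_le_pow_left n.le_succ 4).trans h₃
    exact_mod_cast h
  rw [← mul_assoc]
  refine mul_le_mul_of_nonneg_right ?_ (by positivity)
  calc (n : ℝ) ^ 3 * logCoeff n ≤ (n : ℝ) ^ 3 * (2 * n) := by gcongr; exact logCoeff_le n
    _ = 2 * (n : ℝ) ^ 4 := by ring
    _ ≤ _ := by linarith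

theorem le_fsum_sq_logCoeff {t : ℝ} (ht₀ : 0 < t) (ht₁ : t < 1) :
    6 * t ^ 3 / (1 - t) ^ 4 ≤ fsum (fun n => n * (n * logCoeff n)) t := by
  have hc := hasSum_choose_mul_geometric_of_norm_lt_one 3 (r := t)
    (by rwa [Real.norm_of_nonneg ht₀.le])
  have hs := summable_natCast_mul (summable_natCast_mul summable_logCoeff) t ht₀ ht₁
  have hle : ∑' n : ℕ, 6 * t ^ 3 * (((n + 3).choose 3 : ℝ) * t ^ n) ≤
      ∑' n : ℕ, (((n + 3 : ℕ) : ℝ) * (((n + 3 : ℕ) : ℝ) * logCoeff (n + 3))) * t ^ (n + 3) := by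
    refine (hc.summable.mul_left _).tsum_le_tsum (fun n => ?_)
      ((summable_nat_add_iff 3).2 hs)
    have h₁ : 6 * ((n + 3).choose 3 : ℝ) ≤ ((n + 3 : ℕ) : ℝ) ^ 3 := by
      have h := Nat.descFactorial_le_pow (n + 3) 3
      rw [Nat.descFactorial_eq_factorial_mul_choose] at h
      exact_mod_cast h
    calc 6 * t ^ 3 * (((n + 3).choose 3 : ℝ) * t ^ n)
        = (6 * ((n + 3).choose 3 : ℝ)) * t ^ (n + 3) := by ring
      _ ≤ ((n + 3 : ℕ) : ℝ) ^ 3 * t ^ (n + 3) := by gcongr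
      _ = (((n + 3 : ℕ) : ℝ) * (((n + 3 : ℕ) : ℝ) * ((n + 3 : ℕ) : ℝ))) * t ^ (n + 3) := by ring
      _ ≤ _ := by gcongr; exact natCast_le_logCoeff (n + 3)
  rw [tsum_mul_left, hc.tsum_eq] at hle
  rw [fsum, ← hs.sum_add_tsum_nat_add 3]
  have hnn : 0 ≤ ∑ n ∈ Finset.range 3, ((n : ℝ) * (n * logCoeff n)) * t ^ n :=
    Finset.sum_nonneg fun n _ => mul_nonneg
      (mul_nonneg n.cast_nonneg (mul_nonneg n.cast_nonneg (logCoeff_nonneg n))) (by positivity)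
  calc 6 * t ^ 3 / (1 - t) ^ 4 = 6 * t ^ 3 * (1 / (1 - t) ^ (3 + 1)) := by ring
    _ ≤ _ := hle
    _ ≤ _ := le_add_of_nonneg_left hnn

/-- the MacMahon function `M(z) = ∏_{j≥1} (1 - z^j)^{-j}` (whose
coefficients `a` are characterized by the product identity on `(0,1)`) is Gaussian. -/
theorem statement14 (a : ℕ → ℝ)
    (ha : ∀ t : ℝ, 0 < t → t < 1 →
      HasSum (fun n : ℕ => a n * t ^ n) (∏' j : ℕ, ((1 - t ^ (j + 1)) ^ (j + 1))⁻¹)) :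
    IsGaussian a 1 := by
  have hsum : ∀ t : ℝ, 0 < t → t < 1 → Summable fun n => a n * t ^ n :=
    fun t ht₀ ht₁ => (ha t ht₀ ht₁).summable
  have hab : ∀ t : ℝ, 0 < t → t < 1 → fsum a t = Real.exp (fsum logCoeff t) :=
    fun t ht₀ ht₁ => (ha t ht₀ ht₁).tsum_eq.trans (tprod_eq_exp_fsum_logCoeff ht₀ ht₁)
  have hhalf : ∀ᶠ t in 𝓝[<] (1 : ℝ), t ∈ Set.Ioo (1 / 2 : ℝ) 1 :=
    Ioo_mem_nhdsLT (by norm_num)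
  have hσ : ∀ t ∈ Set.Ioo (1 / 2 : ℝ) 1, (1 / (2 * (1 - t) ^ 2)) ^ 2 ≤ sigma2 a t := by
    rintro t ⟨ht₀, ht₁⟩
    have ht : 0 < t := by linarith
    have h₁ : 0 < 1 - t := sub_pos.2 ht₁
    rw [(moments_of_fsum_eq_exp hsum summable_logCoeff hab ht ht₁).2]
    refine le_trans ?_ (le_fsum_sq_logCoeff ht ht₁)
    have h₂ : (1 / 2 : ℝ) ^ 3 ≤ t ^ 3 := by gcongr
    calc (1 / (2 * (1 - t) ^ 2)) ^ 2 = (1 / 4) / (1 - t) ^ 4 := by field_simp; norm_num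
      _ ≤ 6 * t ^ 3 / (1 - t) ^ 4 := by gcongr; linarith
  refine isGaussian_of_fsum_eq_exp hsum summable_logCoeff hab logCoeff_nonneg ?_ ?_
  · filter_upwards [hhalf] with t ht
    have h₁ : 0 < 1 - t := sub_pos.2 ht.2
    exact lt_of_lt_of_le (by positivity) (hσ t ht)
  · have hlim : Tendsto (fun t : ℝ => 384 * (1 - t)) (𝓝[<] 1) (𝓝 0) := by
      have h : Continuous fun t : ℝ => 384 * (1 - t) := by fun_prop
      simpa using (h.tendsto 1).mono_left nhdsWithin_le_nhds
    refine squeeze_zero' ?_ ?_ hlim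
    · filter_upwards [hhalf] with t ht
      refine div_nonneg (tsum_nonneg fun n => ?_) (pow_nonneg (Real.sqrt_nonneg _) 3)
      have : 0 < t := by linarith [ht.1]
      exact mul_nonneg (mul_nonneg (by positivity) (logCoeff_nonneg n)) (by positivity)
    · filter_upwards [hhalf] with t ht
      have ht₀ : 0 < t := by linarith [ht.1]
      have h₁ : 0 < 1 - t := sub_pos.2 ht.2
      have h₂ : 1 / (2 * (1 - t) ^ 2) ≤ sigma a t := Real.le_sqrt_of_sq_le (hσ t ht)
      calc fsum (fun n => (n : ℝ) ^ 3 * logCoeff n) t / sigma a t ^ 3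
          ≤ (48 / (1 - t) ^ 5) / (1 / (2 * (1 - t) ^ 2)) ^ 3 := by
            gcongr
            exact fsum_cube_logCoeff_le ht₀ ht.2
        _ = 384 * (1 - t) := by field_simp; norm_num

end KhinchinPaper
end
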